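/- arXiv:2009.09517 — 2 statements merged into one kernel-verified Lean document; each statement's English description precedes it below -/
import Mathlib

section
/- Let n ≥ 7 and let a closed planar polygon have side lengths l_1 = l_2 = … = l_{n-1} = 1 and l_n = l with 1 ≤ l < n−1, and suppose the generic-lengths condition holds: Σ_{i=1}^{n} ν_i l_i ≠ 0 for every choice of signs ν_i = ±1. Realize the configuration space M̃ of the polygon as the subspace M̃ = {u ∈ (S¹)^{n−1} : Σ_{i=1}^{n−1} l_i u_i = −l_n} of the (n−1)-torus, where S¹ is the unit circle in ℂ. Then for every basepoint x ∈ M̃, the fundamental group π_1(M̃, x) is isomorphic to the presented group on generators a_1, …, a_{n−1} with relator set consisting of: a_k for every k such that the pair of sides {k, n} is not short, and the commutator [a_i, a_j] = a_i^{-1} a_j^{-1} a_i a_j for every pair i ≠ j such that the triple of sides {i, j, n} is short. -/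
/-- A subset `J` of the sides of a closed polygon with side lengths `L` is *short*
if the sum of the lengths of the sides in `J` is less than the sum of the lengths
of the sides not in `J`. -/
def IsShort {m : ℕ} (L : Fin m → ℝ) (J : Finset (Fin m)) : Prop :=
  ∑ i ∈ J, L i < ∑ i ∈ Jᶜ, L i

namespace PolygonSpace

open Set Topology MeasureTheory Module

section Paths

variable {X : Type*} [TopologicalSpace X]

theorem Path.Quotient.induction_on_cover
    (P : ∀ {x y : X}, Path.Homotopic.Quotient x y → Prop)
    (trans : ∀ {x y z : X} (p : Path.Homotopic.Quotient x y) (q : Path.Homotopic.Quotient y z),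
      P p → P q → P (p.trans q))
    (nhds : ∀ z : X, ∃ U ∈ 𝓝 z, ∀ {x y : X} (γ : Path x y), range γ ⊆ U →
      P (Path.Homotopic.Quotient.mk γ))
    {x y : X} (p : Path.Homotopic.Quotient x y) : P p := by
  obtain ⟨γ, rfl⟩ := Path.Homotopic.Quotient.mk_surjective p
  choose U hU hP using nhds
  obtain ⟨t, t0, tmono, ⟨n, hn⟩, ht⟩ := exists_monotone_Icc_subset_open_cover_unitInterval
    (c := fun z : X ↦ γ ⁻¹' interior (U z))
    (fun z ↦ isOpen_interior.preimage γ.continuous)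
    (fun s _ ↦ mem_iUnion.2 ⟨γ s, mem_interior_iff_mem_nhds.2 (hU _)⟩)
  have key (k : ℕ) : P (Path.Homotopic.Quotient.mk (γ.subpath (t 0) (t k))) := by
    induction k with
    | zero =>
      refine hP (γ (t 0)) _ ?_
      rw [Path.range_subpath]
      simpa using mem_of_mem_nhds (hU (γ (t 0)))
    | succ k ih =>
      obtain ⟨z, hz⟩ := ht k
      have h := trans _ _ ih (hP z (γ.subpath (t k) (t (k + 1))) (by
        rw [Path.range_subpath_of_le _ _ _ (tmono k.le_succ)]
        exact (image_subset_iff.2 hz).trans interior_subset))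
      rwa [← Path.Homotopic.Quotient.mk_trans, Path.Homotopic.Quotient.eq.2
        ⟨Path.Homotopy.subpathTransSubpath γ (t 0) (t k) (t (k + 1))⟩] at h
  have aux : ∀ {x' y' : X} (hx : x' = x) (hy : y' = y),
      P (Path.Homotopic.Quotient.mk (γ.cast hx hy)) → P (Path.Homotopic.Quotient.mk γ) := by
    rintro _ _ rfl rfl h
    exact h
  have h := key n
  rw [t0, hn n le_rfl, Path.subpath_zero_one] at h
  exact aux _ _ h

theorem _root_.IsSimplyConnected.homotopic {V : Set X} (hV : IsSimplyConnected V) {x y : X}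
    (γ γ' : Path x y) (h : range γ ⊆ V) (h' : range γ' ⊆ V) : γ.Homotopic γ' := by
  have := hV.simplyConnectedSpace
  have lift (δ : Path x y) (hδ : range δ ⊆ V) :
      ∃ δ' : Path (⟨x, hδ ⟨0, δ.source⟩⟩ : V) ⟨y, hδ ⟨1, δ.target⟩⟩,
        δ'.map continuous_subtype_val = δ :=
    ⟨{ toFun := fun t ↦ ⟨δ t, hδ ⟨t, rfl⟩⟩
       source' := by simp
       target' := by simp }, rfl⟩
  obtain ⟨δ, hδ⟩ := lift γ h
  obtain ⟨δ', hδ'⟩ := lift γ' h'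
  rw [← hδ, ← hδ']
  exact (SimplyConnectedSpace.paths_homotopic δ δ').map ⟨_, continuous_subtype_val⟩

theorem isSimplyConnected_image_of_injOn {Y : Type*} [TopologicalSpace Y] {f : X → Y}
    (hf : Continuous f) (ho : IsOpenMap f) {B S : Set X} (hB : IsOpen B) (hi : InjOn f B)
    (hSB : S ⊆ B) (hS : IsSimplyConnected S) : IsSimplyConnected (f '' S) := by
  have he : IsEmbedding (B.domRestrict f) :=
    (IsOpenEmbedding.of_continuous_injective_isOpenMap (hf.comp continuous_subtype_val)
      (injOn_iff_injective.1 hi) (ho.comp hB.isOpenMap_subtype_val)).isEmbedding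
  have h1 : IsSimplyConnected ((↑) ⁻¹' S : Set B) := by
    rw [← IsEmbedding.subtypeVal.isSimplyConnected_image, Subtype.image_preimage_coe,
      inter_eq_right.2 hSB]
    exact hS
  have := he.isSimplyConnected_image.2 h1
  rwa [image_domRestrict, inter_eq_left.2 hSB] at this

end Paths

section Codimension

variable {E : Type*} [NormedAddCommGroup E] [NormedSpace ℝ E]

theorem _root_.Convex.isSimplyConnected {T : Set E} (hT : Convex ℝ T) (hne : T.Nonempty) :
    IsSimplyConnected T := by
  have := hT.contractibleSpace hne
  exact SimplyConnectedSpace.ofContractible T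

theorem homotopic_of_convex {S T : Set E} (hT : Convex ℝ T) (hTS : T ⊆ S) {x y : S}
    (γ γ' : Path x y) (h : ∀ t, (γ t : E) ∈ T) (h' : ∀ t, (γ' t : E) ∈ T) : γ.Homotopic γ' := by
  have hV : IsSimplyConnected ((↑) ⁻¹' T : Set S) := by
    rw [← IsEmbedding.subtypeVal.isSimplyConnected_image, Subtype.image_preimage_coe,
      inter_eq_right.2 hTS]
    exact hT.isSimplyConnected ⟨_, h 0⟩
  refine hV.homotopic γ γ' ?_ ?_
  · rintro _ ⟨t, rfl⟩
    exact h t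
  · rintro _ ⟨t, rfl⟩
    exact h' t

/-- The straight path between two points of `S` whose segment lies in `S`. -/
noncomputable def segmentPath {S : Set E} (x y : S) (h : segment ℝ (x : E) y ⊆ S) : Path x y where
  toFun t := ⟨AffineMap.lineMap (x : E) (y : E) (t : ℝ), h (by
    rw [segment_eq_image_lineMap]; exact ⟨t, t.2, rfl⟩)⟩
  continuous_toFun := by
    refine Continuous.subtype_mk ?_ _
    exact AffineMap.lineMap_continuous.comp continuous_subtype_val
  source' := by simp
  target' := by simp

theorem segmentPath_mem {S : Set E} (x y : S) (h : segment ℝ (x : E) y ⊆ S) (t : unitInterval) :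
    (segmentPath x y h t : E) ∈ segment ℝ (x : E) y := by
  rw [segment_eq_image_lineMap]
  exact ⟨t, t.2, rfl⟩

variable [FiniteDimensional ℝ E]

theorem ae_triangle_inter_subset [MeasurableSpace E] [BorelSpace E] (μ : Measure E)
    [μ.IsAddHaarMeasure] (A : AffineSubspace ℝ E)
    (hA : finrank ℝ A.direction + 3 ≤ finrank ℝ E) (x y : E) :
    ∀ᵐ p ∂μ, ∀ z ∈ A, z ∈ convexHull ℝ {x, y, p} → z ∈ segment ℝ x y := by
  rcases (A : Set E).eq_empty_or_nonempty with h | ⟨a, ha⟩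
  · refine Filter.Eventually.of_forall fun p z hz ↦ ?_
    rw [← SetLike.mem_coe, h] at hz
    exact hz.elim
  set W : Submodule ℝ E := A.direction ⊔ Submodule.span ℝ {x - a, y - a} with hW
  have hfin : finrank ℝ W < finrank ℝ E := by
    have h1 := Submodule.finrank_add_le_finrank_add_finrank A.direction
      (Submodule.span ℝ {x - a, y - a})
    have h2 : finrank ℝ (Submodule.span ℝ ({x - a, y - a} : Set E)) ≤ 2 := by
      classical
      have := finrank_span_finset_le_card (R := ℝ) ({x - a, y - a} : Finset E)
      simp only [Finset.coe_insert, Finset.coe_singleton] at this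
      exact this.trans Finset.card_le_two
    change finrank ℝ W ≤ _ at h1
    omega
  have hB : AffineSubspace.mk' a W ≠ ⊤ := by
    intro h
    have : W = ⊤ := by rw [← AffineSubspace.direction_mk' a W, h, AffineSubspace.direction_top]
    rw [this, finrank_top] at hfin
    exact lt_irrefl _ hfin
  have h0 := Measure.addHaar_affineSubspace μ _ hB
  filter_upwards [compl_mem_ae_iff.2 h0] with p hp z hz hzc
  rw [convexHull_insert (by simp), convexHull_pair] at hzc
  simp only [mem_convexJoin, mem_singleton_iff, exists_eq_left] at hzc
  obtain ⟨q, ⟨c, d, hc, hd, hcd, rfl⟩, ⟨α, β, hα, hβ, hαβ, rfl⟩⟩ := hzc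
  by_cases h : β * d = 0
  · rcases mul_eq_zero.1 h with h | h
    · subst h
      obtain rfl : α = 1 := by linarith
      simpa using left_mem_segment ℝ x y
    · subst h
      obtain rfl : c = 1 := by linarith
      exact ⟨α, β, hα, hβ, hαβ, by simp⟩
  · refine absurd ?_ hp
    rw [SetLike.mem_coe, AffineSubspace.mem_mk', vsub_eq_sub]
    have h1 : (α • x + β • (c • y + d • p)) - a ∈ W :=
      Submodule.mem_sup_left (AffineSubspace.vsub_mem_direction hz ha)
    have h2 : x - a ∈ W := Submodule.mem_sup_right (Submodule.subset_span (by simp))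
    have h3 : y - a ∈ W := Submodule.mem_sup_right (Submodule.subset_span (by simp))
    have h4 := W.sub_mem (W.sub_mem h1 (W.smul_mem α h2)) (W.smul_mem (β * c) h3)
    have h5 : (α • x + β • (c • y + d • p)) - a - α • (x - a) - (β * c) • (y - a)
        = (β * d) • (p - a) := by
      obtain rfl : α = 1 - β := by linarith
      obtain rfl : c = 1 - d := by linarith
      module
    rw [h5] at h4
    exact (W.smul_mem_iff h).1 h4

/-- An open subset of a convex open set whose complement therein is covered by countably many
affine subspaces of codimension at least three is simply connected. -/
theorem isSimplyConnected_of_codim_three {C S : Set E} (hC : Convex ℝ C) (hCo : IsOpen C)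
    (hSo : IsOpen S) (hne : C.Nonempty) (hSC : S ⊆ C) {J : Type*} [Countable J]
    (A : J → AffineSubspace ℝ E) (hA : ∀ j, finrank ℝ (A j).direction + 3 ≤ finrank ℝ E)
    (hcov : C \ S ⊆ ⋃ j, (A j : Set E)) : IsSimplyConnected S := by
  borelize E
  let μ : Measure E := Measure.addHaar
  have tri (x y : E) (hx : x ∈ C) (hy : y ∈ C) (hxy : segment ℝ x y ⊆ S) :
      ∀ᵐ p ∂μ, p ∈ C → convexHull ℝ {x, y, p} ⊆ S := by
    filter_upwards [ae_all_iff.2 fun j ↦ ae_triangle_inter_subset μ (A j) (hA j) x y]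
      with p hp hpC z hz
    by_contra hzS
    have hzC : z ∈ C := convexHull_min (by
      rintro _ (rfl | rfl | rfl) <;> assumption) hC hz
    obtain ⟨j, hj⟩ := mem_iUnion.1 (hcov ⟨hzC, hzS⟩)
    exact hzS (hxy (hp j z hj hz))
  have seg (x : S) : ∀ᵐ p ∂μ, p ∈ C → segment ℝ (x : E) p ⊆ S := by
    filter_upwards [tri x x (hSC x.2) (hSC x.2) (by simp)] with p hp hpC
    simpa using hp hpC
  have ex {P : E → Prop} (h : ∀ᵐ p ∂μ, p ∈ C → P p) : ∃ p, P p := by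
    obtain ⟨p, hpC, hp⟩ := (Measure.dense_of_ae h).inter_open_nonempty C hCo hne
    exact ⟨p, hp hpC⟩
  let P {x y : S} (q : Path.Homotopic.Quotient x y) : Prop :=
    ∀ᵐ p ∂μ, p ∈ C → ∃ (hp : p ∈ S) (hx : segment ℝ (x : E) p ⊆ S)
      (hy : segment ℝ (y : E) p ⊆ S),
      q = (Path.Homotopic.Quotient.mk (segmentPath x ⟨p, hp⟩ hx)).trans
        (Path.Homotopic.Quotient.mk (segmentPath y ⟨p, hp⟩ hy)).symm
  have hP {x y : S} (q : Path.Homotopic.Quotient x y) : P q := by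
    refine Path.Quotient.induction_on_cover (P := P) ?_ ?_ q
    · intro x y z p q hp hq
      filter_upwards [hp, hq] with c hcp hcq hc
      obtain ⟨h1, h2, h3, rfl⟩ := hcp hc
      obtain ⟨h1, h4, h5, rfl⟩ := hcq hc
      refine ⟨h1, h2, h5, ?_⟩
      rw [Path.Homotopic.Quotient.trans_assoc, ← Path.Homotopic.Quotient.trans_assoc _ _
        (Path.Homotopic.Quotient.symm _), Path.Homotopic.Quotient.symm_trans,
        Path.Homotopic.Quotient.refl_trans]
    · intro z
      obtain ⟨r, hr, hrS⟩ := Metric.isOpen_iff.1 hSo z z.2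
      refine ⟨(↑) ⁻¹' Metric.ball (z : E) r, continuous_subtype_val.continuousAt.preimage_mem_nhds
        (Metric.ball_mem_nhds _ hr), fun {x y} γ hγ ↦ ?_⟩
      have hb : Convex ℝ (Metric.ball (z : E) r) := convex_ball _ _
      have hγ' (t : unitInterval) : (γ t : E) ∈ Metric.ball (z : E) r := hγ ⟨t, rfl⟩
      have hx : (x : E) ∈ Metric.ball (z : E) r := by simpa using hγ' 0
      have hy : (y : E) ∈ Metric.ball (z : E) r := by simpa using hγ' 1
      have hxy := (hb.segment_subset hx hy).trans hrS
      filter_upwards [tri x y (hSC x.2) (hSC y.2) hxy] with p hp hpC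
      specialize hp hpC
      have hconv := convex_convexHull ℝ {(x : E), (y : E), p}
      have mx : (x : E) ∈ convexHull ℝ {(x : E), (y : E), p} := subset_convexHull _ _ (by simp)
      have my : (y : E) ∈ convexHull ℝ {(x : E), (y : E), p} := subset_convexHull _ _ (by simp)
      have mp : p ∈ convexHull ℝ {(x : E), (y : E), p} := subset_convexHull _ _ (by simp)
      refine ⟨hp mp, (hconv.segment_subset mx mp).trans hp,
        (hconv.segment_subset my mp).trans hp, ?_⟩
      rw [← Path.Homotopic.Quotient.mk_symm, ← Path.Homotopic.Quotient.mk_trans,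
        Path.Homotopic.Quotient.eq]
      refine (homotopic_of_convex hb hrS γ (segmentPath x y hxy) hγ' fun t ↦
        hb.segment_subset hx hy (segmentPath_mem _ _ _ t)).trans
        (homotopic_of_convex hconv hp _ _ (fun t ↦
          hconv.segment_subset mx my (segmentPath_mem _ _ _ t)) fun t ↦ ?_)
      have : (((segmentPath x ⟨p, hp mp⟩ ((hconv.segment_subset mx mp).trans hp)).trans
          (segmentPath y ⟨p, hp mp⟩ ((hconv.segment_subset my mp).trans hp)).symm) t) ∈
          range ((segmentPath x ⟨p, hp mp⟩ ((hconv.segment_subset mx mp).trans hp)).trans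
          (segmentPath y ⟨p, hp mp⟩ ((hconv.segment_subset my mp).trans hp)).symm) := ⟨t, rfl⟩
      rw [Path.trans_range, Path.symm_range] at this
      rcases this with ⟨s, hs⟩ | ⟨s, hs⟩
      · rw [← hs]
        exact hconv.segment_subset mx mp (segmentPath_mem x ⟨p, hp mp⟩ _ s)
      · rw [← hs]
        exact hconv.segment_subset my mp (segmentPath_mem y ⟨p, hp mp⟩ _ s)
  have hSne : Nonempty S := by
    obtain ⟨p, hp⟩ := ex (P := fun p ↦ p ∈ S) (by
      have hnull (j : J) : ∀ᵐ p ∂μ, p ∉ A j := by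
        refine compl_mem_ae_iff.2 (Measure.addHaar_affineSubspace μ (A j) fun h ↦ ?_)
        have := hA j
        rw [h, AffineSubspace.direction_top, finrank_top] at this
        omega
      filter_upwards [ae_all_iff.2 hnull] with p hp hpC
      by_contra hpS
      obtain ⟨j, hj⟩ := mem_iUnion.1 (hcov ⟨hpC, hpS⟩)
      exact hp j hj)
    exact ⟨⟨p, hp⟩⟩
  refine simply_connected_iff_paths_homotopic.2 ⟨⟨hSne, fun x y ↦ ?_⟩, fun x y ↦ ⟨fun q q' ↦ ?_⟩⟩
  · obtain ⟨p, hx, hy⟩ := ex (P := fun p ↦ segment ℝ (x : E) p ⊆ S ∧ segment ℝ (y : E) p ⊆ S) (by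
      filter_upwards [seg x, seg y] with p h1 h2 h3
      exact ⟨h1 h3, h2 h3⟩)
    exact ⟨(segmentPath x ⟨p, hx (right_mem_segment _ _ _)⟩ hx).trans
      (segmentPath y ⟨p, hx (right_mem_segment _ _ _)⟩ hy).symm⟩
  · obtain ⟨p, ⟨_, _, _, h⟩, ⟨_, _, _, h'⟩⟩ := ex ((hP q).mp ((hP q').mono fun p h' h hc ↦
      And.intro (h hc) (h' hc)))
    rw [h, h']

end Codimension

section PathIn

variable {X : Type*} [TopologicalSpace X] {V V' W : Set X} {x y z : X}

/-- The homotopy class of any path in a simply connected set between two of its points. -/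
noncomputable def pathIn (hV : IsSimplyConnected V) (hx : x ∈ V) (hy : y ∈ V) :
    Path.Homotopic.Quotient x y :=
  Path.Homotopic.Quotient.mk (hV.isPathConnected.joinedIn x hx y hy).somePath

theorem mk_eq_pathIn (hV : IsSimplyConnected V) (hx : x ∈ V) (hy : y ∈ V) (γ : Path x y)
    (hγ : range γ ⊆ V) : Path.Homotopic.Quotient.mk γ = pathIn hV hx hy := by
  refine Path.Homotopic.Quotient.eq.2 (hV.homotopic _ _ hγ ?_)
  rintro _ ⟨t, rfl⟩
  exact (hV.isPathConnected.joinedIn x hx y hy).somePath_mem t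

theorem exists_path_eq_pathIn (hV : IsSimplyConnected V) (hW : IsPathConnected W) (hWV : W ⊆ V)
    (hx : x ∈ W) (hy : y ∈ W) : ∃ γ : Path x y, range γ ⊆ W ∧
      pathIn hV (hWV hx) (hWV hy) = Path.Homotopic.Quotient.mk γ := by
  have h : range (hW.joinedIn x hx y hy).somePath ⊆ W := by
    rintro _ ⟨t, rfl⟩
    exact (hW.joinedIn x hx y hy).somePath_mem t
  exact ⟨_, h, (mk_eq_pathIn hV _ _ _ (h.trans hWV)).symm⟩

theorem pathIn_self (hV : IsSimplyConnected V) (hx : x ∈ V) :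
    pathIn hV hx hx = Path.Homotopic.Quotient.refl x := by
  rw [← mk_eq_pathIn hV hx hx (Path.refl x) (by simpa using hx), Path.Homotopic.Quotient.mk_refl]

theorem pathIn_trans (hV : IsSimplyConnected V) (hx : x ∈ V) (hy : y ∈ V) (hz : z ∈ V) :
    (pathIn hV hx hy).trans (pathIn hV hy hz) = pathIn hV hx hz := by
  obtain ⟨γ, h, e⟩ := exists_path_eq_pathIn hV hV.isPathConnected subset_rfl hx hy
  obtain ⟨γ', h', e'⟩ := exists_path_eq_pathIn hV hV.isPathConnected subset_rfl hy hz
  rw [e, e', ← Path.Homotopic.Quotient.mk_trans]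
  refine mk_eq_pathIn hV hx hz _ ?_
  rw [Path.trans_range]
  exact union_subset h h'

theorem pathIn_congr (hV : IsSimplyConnected V) (hV' : IsSimplyConnected V')
    (hW : IsPathConnected W) (hWV : W ⊆ V) (hWV' : W ⊆ V') (hx : x ∈ W) (hy : y ∈ W) :
    pathIn hV (hWV hx) (hWV hy) = pathIn hV' (hWV' hx) (hWV' hy) := by
  obtain ⟨γ, h, e⟩ := exists_path_eq_pathIn hV hW hWV hx hy
  rw [e, mk_eq_pathIn hV' _ _ γ (h.trans hWV')]

end PathIn

/-- A cover of `X` by simply connected open sets `V none` and `V (some k)` such that the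
`V (some k)` meet each other only within `V none`, and each meets `V none` in two path connected
pieces `P k` and `N k`. -/
structure HandleCover (ι X : Type*) [TopologicalSpace X] where
  V : Option ι → Set X
  P : ι → Set X
  N : ι → Set X
  isOpen_V : ∀ α, IsOpen (V α)
  isOpen_P : ∀ k, IsOpen (P k)
  isOpen_N : ∀ k, IsOpen (N k)
  exists_mem : ∀ x, ∃ α, x ∈ V α
  isSimplyConnected_V : ∀ α, IsSimplyConnected (V α)
  isPathConnected_P : ∀ k, IsPathConnected (P k)
  isPathConnected_N : ∀ k, IsPathConnected (N k)
  disjoint : ∀ k, Disjoint (P k) (N k)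
  inter_none : ∀ k, V (some k) ∩ V none = P k ∪ N k
  inter_subset : ∀ k j, k ≠ j → V (some k) ∩ V (some j) ⊆ V none

namespace HandleCover

variable {ι X : Type*} [TopologicalSpace X] (H : HandleCover ι X)

theorem P_subset (k : ι) : H.P k ⊆ H.V (some k) ∩ H.V none := by
  rw [H.inter_none]; exact subset_union_left

theorem N_subset (k : ι) : H.N k ⊆ H.V (some k) ∩ H.V none := by
  rw [H.inter_none]; exact subset_union_right

/-- A point of `P k`. -/
noncomputable def pos (k : ι) : X := (H.isPathConnected_P k).nonempty.some

/-- A point of `N k`. -/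
noncomputable def neg (k : ι) : X := (H.isPathConnected_N k).nonempty.some

theorem pos_mem (k : ι) : H.pos k ∈ H.P k := (H.isPathConnected_P k).nonempty.some_mem

theorem neg_mem (k : ι) : H.neg k ∈ H.N k := (H.isPathConnected_N k).nonempty.some_mem

variable {x₀ : X} (h₀ : x₀ ∈ H.V none)

/-- The path from the base point to a point of `V (some k)` that enters it through `N k`. -/
noncomputable def enter (k : ι) {y : X} (hy : y ∈ H.V (some k)) : Path.Homotopic.Quotient x₀ y :=
  (pathIn (H.isSimplyConnected_V none) h₀ (H.N_subset k (H.neg_mem k)).2).trans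
    (pathIn (H.isSimplyConnected_V (some k)) (H.N_subset k (H.neg_mem k)).1 hy)

/-- The loop that enters `V (some k)` through `N k` and leaves it through `P k`. -/
noncomputable def loop (k : ι) : FundamentalGroup X x₀ :=
  FundamentalGroup.fromPath ((H.enter h₀ k (H.P_subset k (H.pos_mem k)).1).trans
    (pathIn (H.isSimplyConnected_V none) (H.P_subset k (H.pos_mem k)).2 h₀))

/-- The homomorphism sending the generators to the loops of the cover. -/
noncomputable def toFundamentalGroup : FreeGroup ι →* FundamentalGroup X x₀ :=
  FreeGroup.lift (H.loop h₀)

/-- The path to a point of `V none` or `V (some k)` which first runs through a word in the loops. -/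
noncomputable def path : ∀ (α : Option ι) {y : X}, y ∈ H.V α → FreeGroup ι →
    Path.Homotopic.Quotient x₀ y
  | none, _, hy, g => (H.toFundamentalGroup h₀ g).toPath.trans
      (pathIn (H.isSimplyConnected_V none) h₀ hy)
  | some k, _, hy, g => (H.toFundamentalGroup h₀ g).toPath.trans (H.enter h₀ k hy)

theorem enter_trans (k : ι) {y z : X} (hy : y ∈ H.V (some k)) (hz : z ∈ H.V (some k)) :
    (H.enter h₀ k hy).trans (pathIn (H.isSimplyConnected_V _) hy hz) = H.enter h₀ k hz := by
  rw [enter, Path.Homotopic.Quotient.trans_assoc, pathIn_trans, enter]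

theorem path_trans (α : Option ι) {y z : X} (hy : y ∈ H.V α) (hz : z ∈ H.V α)
    (g : FreeGroup ι) :
    (H.path h₀ α hy g).trans (pathIn (H.isSimplyConnected_V α) hy hz) = H.path h₀ α hz g := by
  cases α with
  | none => rw [path, Path.Homotopic.Quotient.trans_assoc, pathIn_trans, path]
  | some k => rw [path, Path.Homotopic.Quotient.trans_assoc, enter_trans, path]

theorem path_of_mem_N {k : ι} {y : X} (hy : y ∈ H.N k) (g : FreeGroup ι) :
    H.path h₀ (some k) (H.N_subset k hy).1 g = H.path h₀ none (H.N_subset k hy).2 g := by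
  rw [path, path, enter, pathIn_congr (H.isSimplyConnected_V _) (H.isSimplyConnected_V none)
    (H.isPathConnected_N k) (fun _ h ↦ (H.N_subset k h).1) (fun _ h ↦ (H.N_subset k h).2)
    (H.neg_mem k) hy, pathIn_trans]

theorem path_of_mem_P {k : ι} {y : X} (hy : y ∈ H.P k) (g : FreeGroup ι) :
    H.path h₀ (some k) (H.P_subset k hy).1 g =
      H.path h₀ none (H.P_subset k hy).2 (FreeGroup.of k * g) := by
  have h1 : (H.toFundamentalGroup h₀ (FreeGroup.of k * g)).toPath =
      (H.toFundamentalGroup h₀ g).toPath.trans (H.loop h₀ k).toPath := by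
    rw [map_mul]
    simp only [toFundamentalGroup, FreeGroup.lift_apply_of]
    rfl
  rw [path, path, h1, loop, Path.Homotopic.Quotient.trans_assoc,
    Path.Homotopic.Quotient.trans_assoc, pathIn_trans,
    ← H.enter_trans h₀ k (H.P_subset k (H.pos_mem k)).1 (H.P_subset k hy).1,
    pathIn_congr (H.isSimplyConnected_V _) (H.isSimplyConnected_V none)
    (H.isPathConnected_P k) (fun _ h ↦ (H.P_subset k h).1) (fun _ h ↦ (H.P_subset k h).2)
    (H.pos_mem k) hy]

theorem exists_path_eq_path_none {α : Option ι} {y : X} (hα : y ∈ H.V α) (hy : y ∈ H.V none) :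
    ∃ t : FreeGroup ι, ∀ g, H.path h₀ α hα g = H.path h₀ none hy (t * g) := by
  cases α with
  | none => exact ⟨1, fun g ↦ by rw [one_mul]⟩
  | some k =>
    have := (H.inter_none k).subset ⟨hα, hy⟩
    rcases this with h | h
    · exact ⟨_, H.path_of_mem_P h₀ h⟩
    · exact ⟨1, fun g ↦ by rw [one_mul]; exact H.path_of_mem_N h₀ h g⟩

theorem exists_path_eq_path {α β : Option ι} {y : X} (hα : y ∈ H.V α) (hβ : y ∈ H.V β)
    (g : FreeGroup ι) : ∃ g', H.path h₀ α hα g = H.path h₀ β hβ g' := by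
  by_cases hy : y ∈ H.V none
  · obtain ⟨s, hs⟩ := H.exists_path_eq_path_none h₀ hα hy
    obtain ⟨t, ht⟩ := H.exists_path_eq_path_none h₀ hβ hy
    exact ⟨t⁻¹ * (s * g), by rw [hs, ht, mul_inv_cancel_left]⟩
  · have : α = β := by
      cases α with
      | none => exact absurd hα hy
      | some k =>
        cases β with
        | none => exact absurd hβ hy
        | some j =>
          by_contra hkj
          exact hy (H.inter_subset k j (fun h ↦ hkj (by rw [h])) ⟨hα, hβ⟩)
    subst this
    exact ⟨g, rfl⟩

theorem toFundamentalGroup_surjective : Function.Surjective (H.toFundamentalGroup h₀) := by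
  have key {x y : X} (q : Path.Homotopic.Quotient x y) :
      ∀ (α β : Option ι) (hx : x ∈ H.V α) (hy : y ∈ H.V β) (g : FreeGroup ι),
        ∃ g', (H.path h₀ α hx g).trans q = H.path h₀ β hy g' := by
    refine Path.Quotient.induction_on_cover (P := fun {x y} q ↦
      ∀ (α β : Option ι) (hx : x ∈ H.V α) (hy : y ∈ H.V β) (g : FreeGroup ι),
        ∃ g', (H.path h₀ α hx g).trans q = H.path h₀ β hy g') ?_ ?_ q
    · intro x y z p q hp hq α β hx hz g
      obtain ⟨γ, hγ⟩ := H.exists_mem y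
      obtain ⟨g', h1⟩ := hp α γ hx hγ g
      obtain ⟨g'', h2⟩ := hq γ β hγ hz g'
      exact ⟨g'', by rw [← Path.Homotopic.Quotient.trans_assoc, h1, h2]⟩
    · intro z
      obtain ⟨c, hc⟩ := H.exists_mem z
      refine ⟨H.V c, (H.isOpen_V c).mem_nhds hc, fun {x y} γ hγ α β hx hy g ↦ ?_⟩
      have hxc : x ∈ H.V c := hγ ⟨0, γ.source⟩
      have hyc : y ∈ H.V c := hγ ⟨1, γ.target⟩
      obtain ⟨g₁, h₁⟩ := H.exists_path_eq_path h₀ hx hxc g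
      obtain ⟨g₂, h₂⟩ := H.exists_path_eq_path h₀ hyc hy g₁
      refine ⟨g₂, ?_⟩
      rw [mk_eq_pathIn (H.isSimplyConnected_V c) hxc hyc γ hγ, h₁, path_trans, h₂]
  intro q
  obtain ⟨g, hg⟩ := key q.toPath none none h₀ h₀ 1
  refine ⟨g, ?_⟩
  simp only [path, pathIn_self, map_one] at hg
  rw [Path.Homotopic.Quotient.trans_refl, Path.Homotopic.Quotient.trans_refl] at hg
  rw [FundamentalGroup.one_def, Path.Homotopic.Quotient.refl_trans] at hg
  exact hg.symm

end HandleCover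

namespace HandleCover

variable {ι X : Type*} [TopologicalSpace X] (H : HandleCover ι X)

open Classical in
/-- The locally constant functions giving the coordinate changes of the universal cover. -/
noncomputable def shift : Option ι → X → FreeGroup ι
  | none, _ => 1
  | some k, x => if x ∈ H.P k then FreeGroup.of k else 1

theorem shift_of_mem_P {k : ι} {x : X} (hx : x ∈ H.P k) :
    H.shift (some k) x = FreeGroup.of k := if_pos hx

theorem shift_of_mem_N {k : ι} {x : X} (hx : x ∈ H.N k) : H.shift (some k) x = 1 :=
  if_neg fun h ↦ disjoint_left.1 (H.disjoint k) h hx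

theorem inter_subset_none {α β : Option ι} (h : α ≠ β) : H.V α ∩ H.V β ⊆ H.V none := by
  cases α with
  | none => exact inter_subset_left
  | some k =>
    cases β with
    | none => exact inter_subset_right
    | some j => exact H.inter_subset k j fun e ↦ h (by rw [e])

theorem continuousOn_shift [TopologicalSpace (FreeGroup ι)] (α : Option ι) :
    ContinuousOn (H.shift α) (H.V α ∩ H.V none) := by
  cases α with
  | none => exact continuousOn_const
  | some k =>
    rw [H.inter_none]
    refine ContinuousOn.union_of_isOpen ?_ ?_ (H.isOpen_P k) (H.isOpen_N k)
    · exact continuousOn_const.congr fun x hx ↦ H.shift_of_mem_P hx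
    · exact continuousOn_const.congr fun x hx ↦ H.shift_of_mem_N hx

variable [TopologicalSpace (FreeGroup ι)] [DiscreteTopology (FreeGroup ι)]

/-- The universal cover as a fiber bundle. -/
noncomputable def bundleCore : FiberBundleCore (Option ι) X (FreeGroup ι) where
  baseSet := H.V
  isOpen_baseSet := H.isOpen_V
  indexAt x := (H.exists_mem x).choose
  mem_baseSet_at x := (H.exists_mem x).choose_spec
  coordChange α β x g := (H.shift β x)⁻¹ * (H.shift α x * g)
  coordChange_self α x _ g := inv_mul_cancel_left _ _
  continuousOn_coordChange α β := by
    by_cases h : α = β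
    · subst h
      exact continuous_snd.continuousOn.congr fun p _ ↦ inv_mul_cancel_left _ _
    · have hα : ContinuousOn (H.shift α) (H.V α ∩ H.V β) := (H.continuousOn_shift α).mono
        fun x hx ↦ ⟨hx.1, H.inter_subset_none h hx⟩
      have hβ : ContinuousOn (H.shift β) (H.V α ∩ H.V β) := (H.continuousOn_shift β).mono
        fun x hx ↦ ⟨hx.2, H.inter_subset_none h hx⟩
      have hm : Continuous fun q : FreeGroup ι × FreeGroup ι × FreeGroup ι ↦
        q.1⁻¹ * (q.2.1 * q.2.2) := continuous_of_discreteTopology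
      have h1 : MapsTo (Prod.fst : X × FreeGroup ι → X) ((H.V α ∩ H.V β) ×ˢ univ)
        (H.V α ∩ H.V β) := fun p hp ↦ hp.1
      exact hm.comp_continuousOn ((hβ.comp continuousOn_fst h1).prodMk
        ((hα.comp continuousOn_fst h1).prodMk continuousOn_snd))
  coordChange_comp α β γ x _ g := by group

theorem isCoveringMap : IsCoveringMap H.bundleCore.proj :=
  FiberBundle.isCoveringMap (F := FreeGroup ι) (E := H.bundleCore.Fiber)

/-- The point of the universal cover with a given coordinate in a chart. -/
noncomputable def lift (α : Option ι) (x : X) (g : FreeGroup ι) : H.bundleCore.proj ⁻¹' {x} :=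
  ⟨⟨x, H.bundleCore.coordChange α (H.bundleCore.indexAt x) x g⟩, rfl⟩

theorem lift_eq_lift {α β : Option ι} {x : X} (g : FreeGroup ι) :
    H.lift α x g = H.lift β x ((H.shift β x)⁻¹ * (H.shift α x * g)) := by
  refine Subtype.ext (congrArg (Bundle.TotalSpace.mk x) ?_)
  change _⁻¹ * _ = _⁻¹ * _
  rw [mul_inv_cancel_left]

theorem lift_injective (α : Option ι) (x : X) : Function.Injective (H.lift α x) := by
  intro g g' h
  have : H.bundleCore.coordChange α (H.bundleCore.indexAt x) x g =
      H.bundleCore.coordChange α (H.bundleCore.indexAt x) x g' := by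
    have h1 := congrArg Subtype.val h
    exact Bundle.TotalSpace.mk_injective (F := FreeGroup ι) (E := H.bundleCore.Fiber) x h1
  exact mul_left_cancel (mul_left_cancel this)

theorem monodromy_pathIn (α : Option ι) {x y : X} (hx : x ∈ H.V α) (hy : y ∈ H.V α)
    (g : FreeGroup ι) :
    H.isCoveringMap.monodromy (pathIn (H.isSimplyConnected_V α) hx hy) (H.lift α x g) =
      H.lift α y g := by
  obtain ⟨γ, hγ, e⟩ := exists_path_eq_pathIn (H.isSimplyConnected_V α)
    (H.isSimplyConnected_V α).isPathConnected subset_rfl hx hy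
  have hc : Continuous fun t ↦ (H.lift α (γ t) g : H.bundleCore.TotalSpace) := by
    have h1 := (H.bundleCore.localTriv α).continuousOn_invFun
    have h2 := h1.comp_continuous (f := fun t ↦ (γ t, g)) (by fun_prop) fun t ↦ by
      exact (H.bundleCore.mem_localTriv_target α _).2 (hγ ⟨t, rfl⟩)
    exact h2
  let Γ : Path (H.lift α x g : H.bundleCore.TotalSpace) (H.lift α y g) :=
    { toFun := fun t ↦ H.lift α (γ t) g
      continuous_toFun := hc
      source' := by rw [γ.source]
      target' := by rw [γ.target] }
  rw [e]
  refine H.isCoveringMap.monodromy_eq_of_map_eq (Path.Homotopic.Quotient.mk Γ) ?_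
  rfl

variable {x₀ : X} (h₀ : x₀ ∈ H.V none)

theorem monodromy_loop (k : ι) (g : FreeGroup ι) :
    H.isCoveringMap.monodromy (H.loop h₀ k).toPath (H.lift none x₀ g) =
      H.lift none x₀ (FreeGroup.of k * g) := by
  rw [loop, enter, IsCoveringMap.monodromy_trans_apply, IsCoveringMap.monodromy_trans_apply,
    monodromy_pathIn, H.lift_eq_lift (β := some k), monodromy_pathIn,
    H.lift_eq_lift (β := none), monodromy_pathIn, H.shift_of_mem_N (H.neg_mem k),
    H.shift_of_mem_P (H.pos_mem k)]
  simp [shift]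

theorem monodromy_toFundamentalGroup (w g : FreeGroup ι) :
    H.isCoveringMap.monodromyPerm x₀ (H.toFundamentalGroup h₀ w) (H.lift none x₀ g) =
      H.lift none x₀ (w * g) := by
  induction w using FreeGroup.induction_on generalizing g with
  | C1 => rw [map_one, map_one, one_mul]; rfl
  | of k =>
    rw [toFundamentalGroup, FreeGroup.lift_apply_of]
    exact H.monodromy_loop h₀ k g
  | inv_of k ih =>
    rw [map_inv, map_inv, Equiv.Perm.inv_eq_iff_eq, ih, mul_inv_cancel_left]
  | mul v w hv hw => rw [map_mul, map_mul, Equiv.Perm.mul_apply, hw, hv, mul_assoc]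

theorem toFundamentalGroup_injective : Function.Injective (H.toFundamentalGroup h₀) := by
  intro v w h
  have h1 := H.monodromy_toFundamentalGroup h₀ v 1
  rw [h, H.monodromy_toFundamentalGroup h₀ w 1] at h1
  simpa using (H.lift_injective none x₀ h1).symm

end HandleCover

theorem HandleCover.nonempty_mulEquiv_of_mem {ι X : Type*} [TopologicalSpace X]
    (H : HandleCover ι X) (x : X) (hx : x ∈ H.V none) :
    Nonempty (FundamentalGroup X x ≃* FreeGroup ι) := by
  let : TopologicalSpace (FreeGroup ι) := ⊥
  have : DiscreteTopology (FreeGroup ι) := ⟨rfl⟩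
  exact ⟨(MulEquiv.ofBijective (H.toFundamentalGroup hx)
    ⟨H.toFundamentalGroup_injective hx, H.toFundamentalGroup_surjective hx⟩).symm⟩

open Filter ComplexConjugate

section Moebius

/-- The Möbius transformation of the unit disc which maps `w` to zero. -/
noncomputable def moebius (w z : ℂ) : ℂ := (z - w) / (1 - conj w * z)

theorem one_sub_conj_mul_ne_zero {w z : ℂ} (hw : ‖w‖ < 1) (hz : ‖z‖ ≤ 1) :
    1 - conj w * z ≠ 0 := by
  intro h
  have h1 : ‖conj w * z‖ = 1 := by rw [← sub_eq_zero.1 h, norm_one]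
  rw [norm_mul, RCLike.norm_conj] at h1
  nlinarith [norm_nonneg w, norm_nonneg z]

theorem conj_mul_self_of_norm_eq_one {u : ℂ} (hu : ‖u‖ = 1) : conj u * u = 1 := by
  rw [Complex.conj_mul', hu]; simp

theorem norm_one_sub_conj_mul {w u : ℂ} (hu : ‖u‖ = 1) : ‖1 - conj w * u‖ = ‖u - w‖ := by
  have : 1 - conj w * u = conj (u - w) * u := by
    rw [map_sub, sub_mul, conj_mul_self_of_norm_eq_one hu]
  rw [this, norm_mul, hu, mul_one, RCLike.norm_conj]

theorem norm_moebius {w u : ℂ} (hw : ‖w‖ < 1) (hu : ‖u‖ = 1) : ‖moebius w u‖ = 1 := by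
  have h := one_sub_conj_mul_ne_zero hw hu.le
  rw [moebius, norm_div, ← norm_one_sub_conj_mul hu, div_self (norm_ne_zero_iff.2 h)]

theorem norm_moebius_lt_one {w z : ℂ} (hw : ‖w‖ < 1) (hz : ‖z‖ < 1) : ‖moebius w z‖ < 1 := by
  have h := one_sub_conj_mul_ne_zero hw hz.le
  rw [moebius, norm_div, div_lt_one (norm_pos_iff.2 h)]
  refine lt_of_pow_lt_pow_left₀ 2 (norm_nonneg _) ?_
  have hw' : w.re * w.re + w.im * w.im < 1 := by
    have := pow_lt_one₀ (norm_nonneg w) hw two_ne_zero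
    rwa [Complex.sq_norm, Complex.normSq_apply] at this
  have hz' : z.re * z.re + z.im * z.im < 1 := by
    have := pow_lt_one₀ (norm_nonneg z) hz two_ne_zero
    rwa [Complex.sq_norm, Complex.normSq_apply] at this
  rw [Complex.sq_norm, Complex.sq_norm, Complex.normSq_apply, Complex.normSq_apply]
  simp only [Complex.sub_re, Complex.sub_im, Complex.mul_re, Complex.mul_im, Complex.conj_re,
    Complex.conj_im, Complex.one_re, Complex.one_im]
  nlinarith [mul_pos (sub_pos.2 hw') (sub_pos.2 hz')]

theorem moebius_injOn {w : ℂ} (hw : ‖w‖ < 1) : InjOn (moebius w) {z | ‖z‖ ≤ 1} := by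
  intro z hz z' hz' h
  rw [moebius, moebius, div_eq_div_iff (one_sub_conj_mul_ne_zero hw hz)
    (one_sub_conj_mul_ne_zero hw hz')] at h
  have h1 : (1 - conj w * w) * (z - z') = 0 := by linear_combination h
  exact sub_eq_zero.1 ((mul_eq_zero.1 h1).resolve_left (one_sub_conj_mul_ne_zero hw hw.le))

theorem moebius_zero_left (z : ℂ) : moebius 0 z = z := by simp [moebius]

theorem moebius_moebius {w v u : ℂ} (hw : ‖w‖ < 1) (hv : ‖v‖ < 1) (hu : ‖u‖ ≤ 1) :
    moebius (moebius w v) (moebius w u) =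
      (1 - w * conj v) / (1 - conj w * v) * moebius v u := by
  have h1 := one_sub_conj_mul_ne_zero hw hu
  have h2 := one_sub_conj_mul_ne_zero hw hv.le
  have h3 := one_sub_conj_mul_ne_zero hv hu
  have h4 := one_sub_conj_mul_ne_zero hw hw.le
  have h5 : 1 - w * conj v ≠ 0 := by
    have := one_sub_conj_mul_ne_zero hv hw.le
    rwa [mul_comm] at this
  have e1 : moebius w u - moebius w v = (1 - conj w * w) * (u - v) /
      ((1 - conj w * u) * (1 - conj w * v)) := by
    rw [moebius, moebius, div_sub_div _ _ h1 h2,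
      div_eq_div_iff (mul_ne_zero h1 h2) (mul_ne_zero h1 h2)]
    ring
  have e2 : 1 - conj (moebius w v) * moebius w u = (1 - conj w * w) * (1 - conj v * u) /
      ((1 - conj w * u) * (1 - w * conj v)) := by
    rw [moebius, moebius]
    simp only [map_div₀, map_sub, map_mul, map_one, Complex.conj_conj]
    rw [div_mul_div_comm, one_sub_div (mul_ne_zero h5 h1),
      div_eq_div_iff (mul_ne_zero h5 h1) (mul_ne_zero h1 h5)]
    ring
  rw [moebius, e1, e2, moebius]
  field_simp

theorem re_conj_mul_moebius_sub {w u : ℂ} (hw : ‖w‖ < 1) (hu : ‖u‖ = 1) :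
    (conj w * moebius w u).re - (conj w * u).re =
      -2 * (conj w * u).im ^ 2 / ‖1 - conj w * u‖ ^ 2 := by
  have h := one_sub_conj_mul_ne_zero hw hu.le
  have e : conj w * moebius w u = (conj w * u - conj w * w) / (1 - conj w * u) := by
    rw [moebius]; ring
  have hr : conj w * w = conj (conj w * u) * (conj w * u) := by
    rw [map_mul, Complex.conj_conj]
    linear_combination (-conj w * w) * conj_mul_self_of_norm_eq_one hu
  rw [e, hr]
  generalize conj w * u = z at h
  have h' : ‖1 - z‖ ^ 2 ≠ 0 := pow_ne_zero 2 (norm_ne_zero_iff.2 h)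
  rw [Complex.div_re, ← Complex.sq_norm, ← add_div, sub_eq_iff_eq_add, div_add' _ _ _ h']
  congr 1
  rw [Complex.sq_norm, Complex.normSq_apply]
  simp only [Complex.sub_re, Complex.sub_im, Complex.mul_re, Complex.mul_im, Complex.conj_re,
    Complex.conj_im, Complex.one_re, Complex.one_im]
  ring

end Moebius

section Barycenter

variable {κ : Type*} [Fintype κ] {Λ : κ → ℝ}

open Classical in
/-- A weighted configuration of points on the circle is stable if no point carries half of the
total weight or more. -/
def Stable (Λ : κ → ℝ) (u : κ → Circle) : Prop :=
  ∀ p : Circle, 2 * ∑ i with u i = p, Λ i < ∑ i, Λ i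

theorem Stable.comp (hΛ : ∀ i, 0 < Λ i) {u : κ → Circle} (hu : Stable Λ u) {f : Circle → Circle}
    (hf : Function.Injective f) : Stable Λ (f ∘ u) := by
  classical
  intro p
  by_cases h : ∃ q, f q = p
  · obtain ⟨q, rfl⟩ := h
    convert hu q using 4
    exact hf.eq_iff
  · have h0 : ∀ i, (f ∘ u) i ≠ p := fun i hi ↦ h ⟨_, hi⟩
    rw [Finset.filter_false_of_mem fun i _ ↦ h0 i, Finset.sum_empty, mul_zero]
    refine lt_of_le_of_lt ?_ (hu p)
    exact mul_nonneg zero_le_two (Finset.sum_nonneg fun i _ ↦ (hΛ i).le)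

/-- The derivative of this potential is the conformal barycenter up to a positive factor. -/
noncomputable def potential (Λ : κ → ℝ) (u : κ → Circle) (w : ℂ) : ℝ :=
  ∑ i, Λ i * (Real.log (‖w - u i‖ ^ 2) - Real.log (1 - ‖w‖ ^ 2))

theorem sub_ne_zero_of_norm_lt {w : ℂ} (hw : ‖w‖ < 1) (u : Circle) : w - u ≠ 0 := by
  intro h
  rw [sub_eq_zero.1 h, Circle.norm_coe] at hw
  exact lt_irrefl _ hw

theorem one_sub_norm_sq_pos {w : ℂ} (hw : ‖w‖ < 1) : 0 < 1 - ‖w‖ ^ 2 :=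
  sub_pos.2 (pow_lt_one₀ (norm_nonneg w) hw two_ne_zero)

theorem moebius_eq {w : ℂ} (hw : ‖w‖ < 1) (u : Circle) :
    (‖w - u‖ ^ 2 : ℝ)⁻¹ • (w - u) + (1 - ‖w‖ ^ 2 : ℝ)⁻¹ • w =
      (-(1 - ‖w‖ ^ 2)⁻¹ : ℝ) • moebius w u := by
  have h1 := one_sub_conj_mul_ne_zero hw (Circle.norm_coe u).le
  have h2 := one_sub_conj_mul_ne_zero hw hw.le
  have h3 := sub_ne_zero_of_norm_lt hw u
  have h4 : conj (w - u) ≠ 0 := (map_ne_zero _).2 h3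
  have h5 : conj (u : ℂ) * u = 1 := conj_mul_self_of_norm_eq_one (Circle.norm_coe u)
  simp only [Complex.real_smul, Complex.ofReal_inv, Complex.ofReal_neg, Complex.ofReal_sub,
    Complex.ofReal_pow, Complex.ofReal_one, ← Complex.conj_mul', moebius]
  have h6 : 1 - conj w * u = - (conj (w - u) * u) := by
    rw [map_sub]; linear_combination -h5
  have h7 : (u : ℂ) ≠ 0 := u.coe_ne_zero
  rw [h6]
  rw [map_sub] at h4 ⊢
  generalize conj (u : ℂ) = u' at *
  generalize conj w = w' at *
  field_simp
  linear_combination (-w) * h5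

theorem hasDerivAt_potential (u : κ → Circle) {w : ℂ} (hw : ‖w‖ < 1) (h : ℂ) :
    HasDerivAt (fun t : ℝ ↦ potential Λ u (w + t • h))
      (inner ℝ ((-2 * (1 - ‖w‖ ^ 2)⁻¹ : ℝ) • ∑ i, Λ i • moebius w (u i)) h) 0 := by
  have hd : HasDerivAt (fun t : ℝ ↦ w + t • h) h 0 := by
    simpa using ((hasDerivAt_id (0 : ℝ)).smul_const h).const_add w
  have h0 : w + (0 : ℝ) • h = w := by simp
  have hi (i : κ) : HasDerivAt (fun t : ℝ ↦ Λ i * (Real.log (‖(w + t • h) - u i‖ ^ 2) -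
      Real.log (1 - ‖w + t • h‖ ^ 2)))
      (Λ i * (2 * inner ℝ (w - u i) h / ‖w - u i‖ ^ 2 -
        -(2 * inner ℝ w h) / (1 - ‖w‖ ^ 2))) 0 := by
    have d1 := (hd.sub_const (u i : ℂ)).norm_sq
    have d2 := hd.norm_sq.const_sub 1
    rw [h0] at d1 d2
    have e1 := d1.log (by
      rw [h0]
      exact pow_ne_zero 2 (norm_ne_zero_iff.2 (sub_ne_zero_of_norm_lt hw _)))
    have e2 := d2.log (by
      rw [h0]
      exact (one_sub_norm_sq_pos hw).ne')
    rw [h0] at e1 e2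
    exact (e1.sub e2).const_mul _
  have hs := HasDerivAt.fun_sum fun i (_ : i ∈ Finset.univ) ↦ hi i
  refine hs.congr_deriv ?_
  rw [Finset.smul_sum, sum_inner]
  refine Finset.sum_congr rfl fun i _ ↦ ?_
  have e : (-2 * (1 - ‖w‖ ^ 2)⁻¹ : ℝ) • Λ i • moebius w (u i) =
      (2 * Λ i) • ((‖w - u i‖ ^ 2 : ℝ)⁻¹ • (w - u i) + (1 - ‖w‖ ^ 2 : ℝ)⁻¹ • w) := by
    rw [moebius_eq hw, smul_smul, smul_smul]
    congr 1
    ring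
  rw [e, inner_smul_left, inner_add_left, inner_smul_left, inner_smul_left]
  simp only [RCLike.conj_to_real]
  ring

theorem sum_moebius_eq_zero_of_isLocalMin {u : κ → Circle} {w : ℂ} (hw : ‖w‖ < 1)
    (h : IsLocalMin (potential Λ u) w) : ∑ i, Λ i • moebius w (u i) = 0 := by
  set v := ∑ i, Λ i • moebius w (u i) with hv
  have h1 := hasDerivAt_potential (Λ := Λ) u hw v
  rw [← hv] at h1
  have hc : ContinuousAt (fun t : ℝ ↦ w + t • v) 0 := by fun_prop
  have h2 : IsLocalMin (fun t : ℝ ↦ potential Λ u (w + t • v)) 0 := by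
    have : Tendsto (fun t : ℝ ↦ w + t • v) (𝓝 0) (𝓝 w) := by simpa using hc.tendsto
    have h3 := this.eventually h
    simpa [IsLocalMin, IsMinFilter] using h3
  have h3 := h2.hasDerivAt_eq_zero h1
  rw [inner_smul_left] at h3
  have := (one_sub_norm_sq_pos hw).ne'
  simpa [this] using h3

/-- A complex number of norm one as a point of the circle. -/
def circleOfNormEqOne (z : ℂ) (h : ‖z‖ = 1) : Circle := ⟨z, mem_sphere_zero_iff_norm.2 h⟩

theorem eq_zero_of_sum_moebius_eq_zero (hΛ : ∀ i, 0 < Λ i) {u : κ → Circle} (hu : Stable Λ u)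
    {w : ℂ} (hw : ‖w‖ < 1) (h0 : ∑ i, Λ i • (u i : ℂ) = 0)
    (h1 : ∑ i, Λ i • moebius w (u i) = 0) : w = 0 := by
  classical
  have re_sum (v : κ → ℂ) (hv : ∑ i, Λ i • v i = 0) : ∑ i, Λ i * (conj w * v i).re = 0 := by
    have := congrArg (fun z ↦ (conj w * z).re) hv
    simp only [mul_zero, Complex.zero_re, Finset.mul_sum, Complex.re_sum] at this
    rw [← this]
    refine Finset.sum_congr rfl fun i _ ↦ ?_
    rw [mul_smul_comm, Complex.smul_re, smul_eq_mul]
  have hsum : ∑ i, Λ i * (2 * (conj w * u i).im ^ 2 / ‖1 - conj w * u i‖ ^ 2) = 0 := by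
    rw [← sub_self (0 : ℝ)]
    nth_rw 1 [← re_sum _ h0]
    rw [← re_sum _ h1, ← Finset.sum_sub_distrib]
    refine Finset.sum_congr rfl fun i _ ↦ ?_
    have := re_conj_mul_moebius_sub hw (Circle.norm_coe (u i))
    linear_combination Λ i * this
  have him (i : κ) : (conj w * u i).im = 0 := by
    have h2 := (Finset.sum_eq_zero_iff_of_nonneg (fun i _ ↦
      mul_nonneg (hΛ i).le (by positivity))).1 hsum i (Finset.mem_univ i)
    have h3 := norm_ne_zero_iff.2 (one_sub_conj_mul_ne_zero hw (Circle.norm_coe (u i)).le)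
    simpa [(hΛ i).ne', h3] using h2
  by_contra hw0
  have hn : ‖w‖ ≠ 0 := norm_ne_zero_iff.2 hw0
  have hn' : (‖w‖ : ℂ) ≠ 0 := Complex.ofReal_ne_zero.2 hn
  have hww : conj w * w = (‖w‖ : ℂ) ^ 2 := Complex.conj_mul' w
  let p : Circle := circleOfNormEqOne (w / ‖w‖) (by simp [hn])
  have hp : (p : ℂ) = w / ‖w‖ := rfl
  have hre (i : κ) : (conj w * u i).re = if u i = p then ‖w‖ else -‖w‖ := by
    have h2 : conj w * u i = ((conj w * u i).re : ℂ) :=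
      (Complex.conj_eq_iff_re.1 (Complex.conj_eq_iff_im.2 (him i))).symm
    have h3 : |(conj w * u i).re| = |‖w‖| := by
      rw [← Real.norm_eq_abs, ← Complex.norm_real, ← h2, norm_mul, Circle.norm_coe,
        RCLike.norm_conj, mul_one, abs_norm]
    split_ifs with h
    · rw [h, hp, mul_div_assoc', hww, pow_two, mul_div_cancel_right₀ _ hn', Complex.ofReal_re]
    · refine (abs_eq_abs.1 h3).resolve_left fun h4 ↦ h ?_
      refine Circle.ext ?_
      rw [h4] at h2
      rw [hp, eq_div_iff hn']
      have h5 : conj w ≠ 0 := (map_ne_zero _).2 hw0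
      refine mul_left_cancel₀ h5 ?_
      rw [hww, ← mul_assoc, h2, pow_two]
  have h2 := re_sum _ h0
  simp only [hre, mul_ite, Finset.sum_ite, ← Finset.sum_mul] at h2
  have h3 := hu p
  rw [← Finset.sum_filter_add_sum_filter_not Finset.univ (fun i ↦ u i = p)] at h3
  have h4 : (∑ i with u i = p, Λ i - ∑ i with ¬ u i = p, Λ i) * ‖w‖ = 0 := by
    linear_combination h2
  have h5 := (mul_eq_zero.1 h4).resolve_right hn
  convert_to 2 * ∑ i with u i = p, Λ i < ∑ i with u i = p, Λ i + ∑ i with ¬ u i = p, Λ i at h3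
  linarith

/-- The Möbius transformation of the circle given by a point of the disc. -/
noncomputable def circleMoebius (w : Metric.ball (0 : ℂ) 1) (u : Circle) : Circle :=
  circleOfNormEqOne (moebius w u) (norm_moebius (mem_ball_zero_iff.1 w.2) (Circle.norm_coe u))

theorem circleMoebius_injective (w : Metric.ball (0 : ℂ) 1) :
    Function.Injective (circleMoebius w) := fun u v h ↦
  Circle.ext (moebius_injOn (mem_ball_zero_iff.1 w.2) (Circle.norm_coe u).le (Circle.norm_coe v).le
    (congrArg Subtype.val h))

theorem eq_of_sum_moebius_eq_zero (hΛ : ∀ i, 0 < Λ i) {u : κ → Circle} (hu : Stable Λ u)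
    {w v : ℂ} (hw : ‖w‖ < 1) (hv : ‖v‖ < 1) (h0 : ∑ i, Λ i • moebius w (u i) = 0)
    (h1 : ∑ i, Λ i • moebius v (u i) = 0) : v = w := by
  refine moebius_injOn hw hv.le hw.le ?_
  have hww : moebius w w = 0 := by simp [moebius]
  rw [hww]
  refine eq_zero_of_sum_moebius_eq_zero hΛ
    (hu.comp hΛ (circleMoebius_injective ⟨w, mem_ball_zero_iff.2 hw⟩)) (norm_moebius_lt_one hw hv)
    h0 ?_
  have h2 (i : κ) : Λ i • moebius (moebius w v) (moebius w (u i)) =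
      (1 - w * conj v) / (1 - conj w * v) * Λ i • moebius v (u i) := by
    rw [moebius_moebius hw hv (Circle.norm_coe (u i)).le, mul_smul_comm]
  refine (Finset.sum_congr rfl fun i _ ↦ h2 i).trans ?_
  rw [← Finset.mul_sum, h1, mul_zero]

theorem continuousAt_potential (u : κ → Circle) {w : ℂ} (hw : ‖w‖ < 1) :
    ContinuousAt (fun q : (κ → Circle) × ℂ ↦ potential Λ q.1 q.2) (u, w) := by
  refine tendsto_finsetSum _ fun i _ ↦ ?_
  refine ContinuousAt.mul continuousAt_const (ContinuousAt.sub ?_ ?_)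
  · refine ContinuousAt.log (by fun_prop) ?_
    exact pow_ne_zero 2 (norm_ne_zero_iff.2 (sub_ne_zero_of_norm_lt hw _))
  · refine ContinuousAt.log (by fun_prop) ?_
    exact (one_sub_norm_sq_pos hw).ne'

theorem continuousAt_potential_right (u : κ → Circle) {w : ℂ} (hw : ‖w‖ < 1) :
    ContinuousAt (potential Λ u) w :=
  (continuousAt_potential u hw).comp (f := fun w ↦ (u, w)) (by fun_prop)

theorem eventually_potential_pos (hΛ : ∀ i, 0 < Λ i) {u : κ → Circle} (hu : Stable Λ u)
    (p : Circle) : ∀ᶠ w in 𝓝 (p : ℂ), ‖w‖ < 1 → 0 < potential Λ u w := by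
  classical
  let c (i : κ) : ℝ := Real.log (‖(p : ℂ) - u i‖ ^ 2) - 1
  have hc (i : κ) : ∀ᶠ w in 𝓝 (p : ℂ), u i ≠ p → c i < Real.log (‖w - (u i : ℂ)‖ ^ 2) := by
    by_cases h : u i = p
    · exact Eventually.of_forall fun w h' ↦ absurd h h'
    · have : ContinuousAt (fun w : ℂ ↦ Real.log (‖w - u i‖ ^ 2)) (p : ℂ) := by
        refine ContinuousAt.log (by fun_prop) (pow_ne_zero 2 (norm_ne_zero_iff.2 ?_))
        rw [sub_ne_zero]
        exact fun h' ↦ h (Circle.ext h'.symm)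
      filter_upwards [this.eventually (lt_mem_nhds (sub_one_lt _))] with w hw _
      exact hw
  set a := ∑ i with u i = p, Λ i
  set b := ∑ i with ¬ u i = p, Λ i
  have hab : 0 < b - a := by
    have h3 := hu p
    rw [← Finset.sum_filter_add_sum_filter_not Finset.univ (fun i ↦ u i = p)] at h3
    convert_to 2 * a < a + b at h3
    linarith
  set C := ∑ i, Λ i * (if u i = p then -2 * Real.log 2 else c i)
  have hd : ∀ᶠ w in 𝓝 (p : ℂ), 1 - ‖w‖ ^ 2 < Real.exp (C / (b - a)) := by
    have h1 : ContinuousAt (fun w : ℂ ↦ 1 - ‖w‖ ^ 2) (p : ℂ) := by fun_prop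
    refine h1.eventually (gt_mem_nhds ?_)
    have := Circle.norm_coe p
    simp only [this]
    simpa using Real.exp_pos _
  filter_upwards [hd, eventually_all.2 hc] with w hdw hcw hw
  have hpos := one_sub_norm_sq_pos hw
  set L := Real.log (1 - ‖w‖ ^ 2)
  have hL : L * (b - a) < C := by
    rw [← lt_div_iff₀ hab]
    exact (Real.log_lt_iff_lt_exp hpos).2 hdw
  have hlow : ∑ i, Λ i * ((if u i = p then -2 * Real.log 2 else c i) +
      (if u i = p then 1 else -1) * L) ≤ potential Λ u w := by
    refine Finset.sum_le_sum fun i _ ↦ mul_le_mul_of_nonneg_left ?_ (hΛ i).le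
    split_ifs with h
    · have h1 : (1 - ‖w‖ ^ 2) / 2 ≤ ‖w - u i‖ := by
        have h2 := norm_sub_norm_le (u i : ℂ) w
        rw [Circle.norm_coe, norm_sub_rev] at h2
        nlinarith [norm_nonneg w]
      have h3 : Real.log (((1 - ‖w‖ ^ 2) / 2) ^ 2) ≤ Real.log (‖w - (u i : ℂ)‖ ^ 2) := by
        refine Real.log_le_log (by positivity) ?_
        gcongr
      rw [Real.log_pow, Real.log_div hpos.ne' two_ne_zero] at h3
      push_cast at h3
      linarith
    · have := hcw i h
      linarith
  refine lt_of_lt_of_le ?_ hlow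
  have hs : ∑ i, Λ i * (if u i = p then (1 : ℝ) else -1) = a - b := by
    simp only [mul_ite, Finset.sum_ite, mul_one, mul_neg, Finset.sum_neg_distrib]
    rw [← sub_eq_add_neg]
  simp only [mul_add, Finset.sum_add_distrib, ← mul_assoc]
  rw [← Finset.sum_mul, hs]
  linarith

theorem exists_potential_le (hΛ : ∀ i, 0 < Λ i) {u : κ → Circle} (hu : Stable Λ u) :
    ∃ w : ℂ, ‖w‖ < 1 ∧ ∀ v : ℂ, ‖v‖ < 1 → potential Λ u w ≤ potential Λ u v := by
  let s : Set ℂ := {w | ‖w‖ < 1 ∧ potential Λ u w ≤ 0}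
  have hs : IsCompact s := by
    have hsb : s ⊆ Metric.ball (0 : ℂ) 1 := fun w hw ↦ mem_ball_zero_iff.2 hw.1
    refine Metric.isCompact_of_isClosed_isBounded ?_ (Metric.isBounded_ball.subset hsb)
    rw [← isOpen_compl_iff, isOpen_iff_mem_nhds]
    intro w hw
    rcases lt_trichotomy ‖w‖ 1 with h | h | h
    · have h1 : 0 < potential Λ u w := by
        by_contra h2
        exact hw ⟨h, not_lt.1 h2⟩
      filter_upwards [(continuousAt_potential_right u h).eventually (lt_mem_nhds h1)] with v hv hvs
      exact hv.not_ge hvs.2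
    · filter_upwards [eventually_potential_pos hΛ hu (circleOfNormEqOne w h)]
        with v hv hvs
      exact (hv hvs.1).not_ge hvs.2
    · filter_upwards [continuous_norm.continuousAt.eventually (lt_mem_nhds h)] with v hv hvs
      exact hv.not_gt hvs.1
  have h0 : (0 : ℂ) ∈ s := ⟨by simp, by simp [potential, Circle.norm_coe]⟩
  obtain ⟨w, hw, hmin⟩ := hs.exists_isMinOn ⟨0, h0⟩ fun w hw ↦
    (continuousAt_potential_right u hw.1).continuousWithinAt
  refine ⟨w, hw.1, fun v hv ↦ ?_⟩
  by_cases h : potential Λ u v ≤ 0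
  · exact hmin ⟨hv, h⟩
  · exact hw.2.trans (not_le.1 h).le

theorem sum_moebius_eq_zero_of_forall_le {u : κ → Circle} {w : ℂ} (hw : ‖w‖ < 1)
    (h : ∀ v : ℂ, ‖v‖ < 1 → potential Λ u w ≤ potential Λ u v) :
    ∑ i, Λ i • moebius w (u i) = 0 :=
  sum_moebius_eq_zero_of_isLocalMin hw <| by
    filter_upwards [continuous_norm.continuousAt.eventually (gt_mem_nhds hw)] with v hv
    exact h v hv

/-- Stable configurations have a unique conformal barycenter, which depends continuously on the
configuration. -/
theorem exists_barycenter (hΛ : ∀ i, 0 < Λ i) :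
    ∃ b : {u : κ → Circle // Stable Λ u} → Metric.ball (0 : ℂ) 1, Continuous b ∧
      ∀ u, ∀ w : Metric.ball (0 : ℂ) 1,
        ∑ i, Λ i • moebius w (u.1 i) = 0 ↔ w = b u := by
  choose b hb hmin using fun u : {u : κ → Circle // Stable Λ u} ↦ exists_potential_le hΛ u.2
  have hzero (u) := sum_moebius_eq_zero_of_forall_le (hb u) (hmin u)
  refine ⟨fun u ↦ ⟨b u, mem_ball_zero_iff.2 (hb u)⟩, ?_, fun u w ↦ ⟨fun h ↦ Subtype.ext ?_, ?_⟩⟩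
  · refine Continuous.subtype_mk ?_ _
    rw [continuous_iff_continuousAt]
    intro u
    rw [ContinuousAt, (Metric.nhds_basis_closedBall (x := b u)).tendsto_right_iff]
    intro ε hε
    obtain ⟨r, hr, hrb⟩ := Metric.isOpen_iff.1 (Metric.isOpen_ball (x := (0 : ℂ)) (ε := 1)) (b u)
      (mem_ball_zero_iff.2 (hb u))
    set δ := min ε (r / 2) with hδ
    have hδ0 : 0 < δ := lt_min hε (half_pos hr)
    have hball : Metric.closedBall (b u) δ ⊆ {v | ‖v‖ < 1} := by
      refine (Metric.closedBall_subset_ball ?_).trans (hrb.trans fun v hv ↦ mem_ball_zero_iff.1 hv)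
      exact (min_le_right _ _).trans_lt (half_lt_self hr)
    have hlt : ∀ v ∈ Metric.sphere (b u) δ, potential Λ u (b u) < potential Λ u v := by
      intro v hv
      have hv1 : ‖v‖ < 1 := hball (Metric.sphere_subset_closedBall hv)
      refine lt_of_le_of_ne (hmin u v hv1) fun h ↦ ?_
      have := eq_of_sum_moebius_eq_zero hΛ u.2 (hb u) hv1 (hzero u)
        (sum_moebius_eq_zero_of_forall_le hv1 fun v' hv' ↦ h ▸ hmin u v' hv')
      rw [this, Metric.mem_sphere, dist_self] at hv
      exact hδ0.ne hv
    have hev : ∀ᶠ u' in 𝓝 u, ∀ v ∈ Metric.sphere (b u) δ,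
        potential Λ u'.1 (b u) < potential Λ u'.1 v := by
      refine (isCompact_sphere (b u) δ).eventually_forall_of_forall_eventually fun v hv ↦ ?_
      have hv1 : ‖v‖ < 1 := hball (Metric.sphere_subset_closedBall hv)
      have h1 : ContinuousAt (fun q : {u : κ → Circle // Stable Λ u} × ℂ ↦
          potential Λ q.1.1 (b u)) (u, v) :=
        ContinuousAt.comp (x := (u, v))
          (f := fun q : {u : κ → Circle // Stable Λ u} × ℂ ↦ (q.1.1, b u))
          (continuousAt_potential (Λ := Λ) u.1 (hb u))
          ((continuous_subtype_val.comp continuous_fst).prodMk continuous_const).continuousAt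
      have h2 : ContinuousAt (fun q : {u : κ → Circle // Stable Λ u} × ℂ ↦
          potential Λ q.1.1 q.2) (u, v) :=
        ContinuousAt.comp (x := (u, v))
          (f := fun q : {u : κ → Circle // Stable Λ u} × ℂ ↦ (q.1.1, q.2))
          (continuousAt_potential (Λ := Λ) u.1 hv1)
          ((continuous_subtype_val.comp continuous_fst).prodMk continuous_snd).continuousAt
      exact h1.eventually_lt h2 (hlt v hv)
    filter_upwards [hev] with u' hu'
    obtain ⟨w, hw, hwmin⟩ := (isCompact_closedBall (b u) δ).exists_isMinOn
      ⟨b u, Metric.mem_closedBall_self hδ0.le⟩ (f := potential Λ u'.1) fun w hw ↦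
      (continuousAt_potential_right u'.1 (hball hw)).continuousWithinAt
    have hwb : w ∈ Metric.ball (b u) δ := by
      refine lt_of_le_of_ne (Metric.mem_closedBall.1 hw) fun h ↦ ?_
      exact (hu' w h).not_ge (hwmin (Metric.mem_closedBall_self hδ0.le))
    have hloc : IsLocalMin (potential Λ u'.1) w := by
      filter_upwards [Metric.isOpen_ball.mem_nhds hwb] with v hv
      exact hwmin (Metric.ball_subset_closedBall hv)
    have := eq_of_sum_moebius_eq_zero hΛ u'.2 (hball hw) (hb u')
      (sum_moebius_eq_zero_of_isLocalMin (hball hw) hloc) (hzero u')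
    rw [this]
    exact Metric.closedBall_subset_closedBall (min_le_left _ _) hw
  · exact eq_of_sum_moebius_eq_zero hΛ u.2 (hb u) (mem_ball_zero_iff.1 w.2) (hzero u) h
  · rintro rfl
    exact hzero u

end Barycenter

section Stable

variable {κ : Type*} [Fintype κ] {Λ : κ → ℝ}

theorem stable_of_sum_eq_zero (hΛ : ∀ i, 0 < Λ i)
    (hgen : ∀ A : Finset κ, 2 * ∑ i ∈ A, Λ i ≠ ∑ i, Λ i) {u : κ → Circle}
    (h0 : ∑ i, Λ i • (u i : ℂ) = 0) : Stable Λ u := by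
  classical
  intro p
  refine lt_of_le_of_ne ?_ (by convert hgen (Finset.univ.filter fun i ↦ u i = p))
  convert_to 2 * ∑ i with u i = p, Λ i ≤ ∑ i, Λ i
  rw [← Finset.sum_filter_add_sum_filter_not Finset.univ (fun i ↦ u i = p)] at h0 ⊢
  have h1 : ∑ i with u i = p, Λ i • (u i : ℂ) = (∑ i with u i = p, Λ i) • (p : ℂ) := by
    rw [Finset.sum_smul]
    refine Finset.sum_congr rfl fun i hi ↦ ?_
    rw [(Finset.mem_filter.1 hi).2]
  have h2 : ‖∑ i with ¬ u i = p, Λ i • (u i : ℂ)‖ ≤ ∑ i with ¬ u i = p, Λ i := by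
    refine norm_sum_le_of_le _ fun i _ ↦ ?_
    rw [norm_smul, Circle.norm_coe, mul_one, Real.norm_of_nonneg (hΛ i).le]
  have h3 : ‖∑ i with u i = p, Λ i • (u i : ℂ)‖ = ∑ i with u i = p, Λ i := by
    rw [h1, norm_smul, Circle.norm_coe, mul_one,
      Real.norm_of_nonneg (Finset.sum_nonneg fun i _ ↦ (hΛ i).le)]
  rw [eq_neg_of_add_eq_zero_right h0, norm_neg, h3] at h2
  linarith

end Stable

section Normalized

/-- The Möbius transformation of the circle given by a point of the disc, normalized to fix one. -/
noncomputable def fixMoebius (w : Metric.ball (0 : ℂ) 1) (u : Circle) : Circle :=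
  (circleMoebius w 1)⁻¹ * circleMoebius w u

theorem fixMoebius_one (w : Metric.ball (0 : ℂ) 1) : fixMoebius w 1 = 1 := inv_mul_cancel _

theorem fixMoebius_injective (w : Metric.ball (0 : ℂ) 1) : Function.Injective (fixMoebius w) :=
  (mul_right_injective _).comp (circleMoebius_injective w)

theorem circleMoebius_of_eq_zero {w : Metric.ball (0 : ℂ) 1} (hw : (w : ℂ) = 0) (u : Circle) :
    circleMoebius w u = u := by
  refine Circle.ext ?_
  change moebius w u = u
  rw [hw, moebius_zero_left]

theorem fixMoebius_of_eq_zero {w : Metric.ball (0 : ℂ) 1} (hw : (w : ℂ) = 0) (u : Circle) :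
    fixMoebius w u = u := by
  rw [fixMoebius, circleMoebius_of_eq_zero hw, circleMoebius_of_eq_zero hw, inv_one, one_mul]

theorem continuous_circleMoebius :
    Continuous fun q : Metric.ball (0 : ℂ) 1 × Circle ↦ circleMoebius q.1 q.2 := by
  refine Continuous.subtype_mk ?_ _
  refine Continuous.div (by fun_prop) (by fun_prop) fun q ↦ ?_
  exact one_sub_conj_mul_ne_zero (mem_ball_zero_iff.1 q.1.2) (Circle.norm_coe q.2).le

theorem continuous_fixMoebius :
    Continuous fun q : Metric.ball (0 : ℂ) 1 × Circle ↦ fixMoebius q.1 q.2 :=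
  (continuous_circleMoebius.comp (continuous_fst.prodMk continuous_const)).inv.mul
    continuous_circleMoebius

end Normalized

/-- The configuration space of closed polygons with `m` sides of length one and one side of
length `l`. -/
abbrev Config (m : ℕ) (l : ℝ) : Type :=
  {u : Fin m → ℂ // (∀ i, ‖u i‖ = 1) ∧ ∑ i, u i = -(l : ℂ)}

/-- The weights of the points on the circle. -/
def weight (m : ℕ) (l : ℝ) (o : Option (Fin m)) : ℝ := o.elim l fun _ ↦ 1

/-- Adjoin the point one to a configuration. -/
noncomputable def withOne {m : ℕ} (u : Fin m → Circle) (o : Option (Fin m)) : Circle := o.elim 1 u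

/-- The configurations which are stable after adjoining the point one with weight `l`. -/
def stableSet (m : ℕ) (l : ℝ) : Set (Fin m → Circle) := {u | Stable (weight m l) (withOne u)}

variable {m : ℕ} {l : ℝ}

theorem weight_pos (hl : 0 < l) (o : Option (Fin m)) : 0 < weight m l o := by
  cases o with
  | none => exact hl
  | some i => exact one_pos

theorem continuous_withOne : Continuous (withOne (m := m)) :=
  continuous_pi fun o ↦ by
    cases o with
    | none => exact continuous_const
    | some i => exact continuous_apply i

theorem withOne_fixMoebius (w : Metric.ball (0 : ℂ) 1) (u : Fin m → Circle) :
    withOne (fun i ↦ fixMoebius w (u i)) = fixMoebius w ∘ withOne u := by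
  funext o
  cases o with
  | none => exact (fixMoebius_one w).symm
  | some i => rfl

theorem fixMoebius_mem_stableSet (hl : 0 < l) {u : Fin m → Circle} (hu : u ∈ stableSet m l)
    (w : Metric.ball (0 : ℂ) 1) : (fun i ↦ fixMoebius w (u i)) ∈ stableSet m l := by
  change Stable _ _
  rw [withOne_fixMoebius]
  exact Stable.comp (weight_pos hl) hu (fixMoebius_injective w)

/-- Scaling of the open unit disc. -/
noncomputable def scaleBall (s : unitInterval) (w : Metric.ball (0 : ℂ) 1) :
    Metric.ball (0 : ℂ) 1 :=
  ⟨(s : ℝ) • (w : ℂ), by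
    have := mem_ball_zero_iff.1 w.2
    rw [mem_ball_zero_iff, norm_smul, Real.norm_of_nonneg s.2.1]
    nlinarith [s.2.1, s.2.2, norm_nonneg (w : ℂ)]⟩

theorem continuous_scaleBall :
    Continuous fun q : unitInterval × Metric.ball (0 : ℂ) 1 ↦ scaleBall q.1 q.2 :=
  Continuous.subtype_mk ((continuous_subtype_val.comp continuous_fst).smul
    (continuous_subtype_val.comp continuous_snd)) _

theorem sum_weight_smul (u : Option (Fin m) → ℂ) :
    ∑ o, weight m l o • u o = l * u none + ∑ i, u (some i) := by
  rw [Fintype.sum_option]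
  refine congrArg₂ _ (Complex.real_smul) (Finset.sum_congr rfl fun i _ ↦ one_smul _ _)

/-- The points on the circle of a closed polygon. -/
def Config.toCircle (u : Config m l) (i : Fin m) : Circle := circleOfNormEqOne (u.1 i) (u.2.1 i)

theorem Config.continuous_toCircle : Continuous (Config.toCircle (m := m) (l := l)) :=
  continuous_pi fun i ↦ Continuous.subtype_mk
    ((continuous_apply i).comp continuous_subtype_val) _

theorem Config.sum_weight_smul (u : Config m l) :
    ∑ o, weight m l o • (withOne u.toCircle o : ℂ) = 0 := by
  refine (PolygonSpace.sum_weight_smul _).trans ?_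
  have h1 : ∑ i, (withOne u.toCircle (some i) : ℂ) = ∑ i, u.1 i := rfl
  have h2 : (withOne u.toCircle none : ℂ) = 1 := rfl
  linear_combination h1 + u.2.2 + l * h2

theorem sum_fixMoebius {u : Fin m → Circle} {w : Metric.ball (0 : ℂ) 1}
    (h : ∑ o, weight m l o • moebius w (withOne u o) = 0) :
    ∑ i, (fixMoebius w (u i) : ℂ) = -(l : ℂ) := by
  rw [sum_weight_smul fun o ↦ moebius w (withOne u o)] at h
  have h1 (v : Circle) : (fixMoebius w v : ℂ) = (circleMoebius w 1 : ℂ)⁻¹ * moebius w v := by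
    rw [fixMoebius, Circle.coe_mul, Circle.coe_inv]
    rfl
  have h2 : (circleMoebius w 1 : ℂ)⁻¹ * moebius w (withOne u none) = 1 := by
    refine (h1 1).symm.trans ?_
    rw [fixMoebius_one, Circle.coe_one]
  have h3 : ∑ i, (fixMoebius w (u i) : ℂ) =
      (circleMoebius w 1 : ℂ)⁻¹ * ∑ i, moebius w (withOne u (some i)) :=
    (Finset.sum_congr rfl fun i _ ↦ h1 (u i)).trans (Finset.mul_sum ..).symm
  linear_combination h3 + (circleMoebius w 1 : ℂ)⁻¹ * h - l * h2

theorem exists_continuousMap_ball (hl : 0 < l) : ∃ c : C(stableSet m l, Metric.ball (0 : ℂ) 1),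
    ∀ (u) (w : Metric.ball (0 : ℂ) 1),
      ∑ o, weight m l o • moebius w (withOne u.1 o) = 0 ↔ w = c u := by
  obtain ⟨b, hb, hbz⟩ := exists_barycenter (weight_pos (m := m) hl)
  exact ⟨⟨fun u ↦ b ⟨withOne u.1, u.2⟩,
      hb.comp (Continuous.subtype_mk (continuous_withOne.comp continuous_subtype_val) _)⟩,
    fun u w ↦ hbz ⟨withOne u.1, u.2⟩ w⟩

theorem continuous_fixMoebius_stableSet (hl : 0 < l) {Z : Type*} [TopologicalSpace Z]
    {f : Z → Metric.ball (0 : ℂ) 1} (hf : Continuous f) {g : Z → stableSet m l}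
    (hg : Continuous g) : Continuous fun z ↦ (⟨fun i ↦ fixMoebius (f z) ((g z).1 i),
      fixMoebius_mem_stableSet hl (g z).2 _⟩ : stableSet m l) :=
  Continuous.subtype_mk (continuous_pi fun i ↦ continuous_fixMoebius.comp
    (hf.prodMk ((continuous_apply i).comp (continuous_subtype_val.comp hg)))) _

/-- The configuration space is homotopy equivalent to the space of stable configurations. -/
theorem nonempty_homotopyEquiv (hl : 0 < l)
    (hgen : ∀ A : Finset (Option (Fin m)),
      2 * ∑ o ∈ A, weight m l o ≠ ∑ o, weight m l o) :
    Nonempty (ContinuousMap.HomotopyEquiv (Config m l) (stableSet m l)) := by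
  obtain ⟨c, hc⟩ := exists_continuousMap_ball (m := m) hl
  let inc : C(Config m l, stableSet m l) :=
    ⟨fun u ↦ ⟨u.toCircle, stable_of_sum_eq_zero (weight_pos hl) hgen u.sum_weight_smul⟩,
      Continuous.subtype_mk Config.continuous_toCircle _⟩
  let act : C(unitInterval × stableSet m l, stableSet m l) :=
    ⟨_, continuous_fixMoebius_stableSet hl
      (continuous_scaleBall.comp (continuous_fst.prodMk (c.continuous.comp continuous_snd)))
      continuous_snd⟩
  let ret : C(stableSet m l, Config m l) :=
    ⟨fun u ↦ ⟨fun i ↦ (fixMoebius (c u) (u.1 i) : ℂ), fun i ↦ Circle.norm_coe _,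
        sum_fixMoebius ((hc u _).2 rfl)⟩,
      Continuous.subtype_mk (continuous_pi fun i ↦ continuous_subtype_val.comp
        ((continuous_apply i).comp (continuous_subtype_val.comp
          (continuous_fixMoebius_stableSet hl c.continuous continuous_id)))) _⟩
  have h1 : ret.comp inc = ContinuousMap.id _ := by
    refine ContinuousMap.ext fun u ↦ Subtype.ext (funext fun i ↦ ?_)
    have h0 : (⟨0, by simp⟩ : Metric.ball (0 : ℂ) 1) = c (inc u) := by
      refine (hc _ _).1 ((Finset.sum_congr rfl fun o _ ↦ ?_).trans u.sum_weight_smul)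
      exact congrArg _ (moebius_zero_left _)
    exact congrArg Subtype.val
      (fixMoebius_of_eq_zero (congrArg Subtype.val h0).symm (u.toCircle i))
  have h2 (u) : act (0, u) = u :=
    Subtype.ext (funext fun i ↦ fixMoebius_of_eq_zero (zero_smul ℝ _) _)
  have h3 (u) : act (1, u) = inc (ret u) := by
    have : scaleBall 1 (c u) = c u := Subtype.ext (one_smul ℝ _)
    exact Subtype.ext (funext fun i ↦ congrArg (fixMoebius · (u.1 i)) this)
  exact ⟨⟨inc, ret, h1 ▸ ContinuousMap.Homotopic.refl _,
    ContinuousMap.Homotopic.symm ⟨⟨act, h2, h3⟩⟩⟩⟩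

theorem nonempty_fundamentalGroup_mulEquiv {X Y : Type} [TopologicalSpace X] [TopologicalSpace Y]
    (e : ContinuousMap.HomotopyEquiv X Y) (x : X) :
    ∃ y : Y, Nonempty (FundamentalGroup X x ≃* FundamentalGroup Y y) := by
  let F := FundamentalGroupoidFunctor.equivOfHomotopyEquiv (X := TopCat.of X) (Y := TopCat.of Y) e
  exact ⟨(F.functor.obj ⟨x⟩).as, ⟨F.fullyFaithfulFunctor.mulEquivEnd ⟨x⟩⟩⟩

section Stable

variable {κ : Type*} [Fintype κ] {Λ : κ → ℝ}

theorem eventually_stable [Nonempty κ] (hΛ : ∀ i, 0 < Λ i) {u : κ → Circle} (hu : Stable Λ u) :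
    ∀ᶠ v in 𝓝 u, Stable Λ v := by
  classical
  have h (i j : κ) : ∀ᶠ v in 𝓝 u, v i = v j → u i = u j := by
    by_cases hij : u i = u j
    · exact Eventually.of_forall fun _ _ ↦ hij
    · filter_upwards [(isOpen_ne_fun (continuous_apply i) (continuous_apply j)).mem_nhds
          (show u ∈ {v : κ → Circle | v i ≠ v j} from hij)]
        with v hv hv' using absurd hv' hv
  filter_upwards [eventually_all.2 fun i ↦ eventually_all.2 (h i)] with v hv p
  by_cases hp : ∃ j, v j = p
  · obtain ⟨j, rfl⟩ := hp
    refine lt_of_le_of_lt (mul_le_mul_of_nonneg_left ?_ zero_le_two) (hu (u j))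
    refine Finset.sum_le_sum_of_subset_of_nonneg (fun i hi ↦ ?_) fun i _ _ ↦ (hΛ i).le
    simp only [Finset.mem_filter, Finset.mem_univ, true_and] at hi ⊢
    exact hv i j hi
  · rw [Finset.filter_false_of_mem fun i _ hi ↦ hp ⟨i, hi⟩, Finset.sum_empty, mul_zero]
    exact Finset.sum_pos (fun i _ ↦ hΛ i) Finset.univ_nonempty

end Stable

theorem isOpen_stableSet (hl : 0 < l) : IsOpen (stableSet m l) :=
  isOpen_iff_mem_nhds.2 fun _ hu ↦
    continuous_withOne.continuousAt.eventually (eventually_stable (weight_pos hl) hu)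

theorem sum_weight : ∑ o, weight m l o = l + m := by
  rw [Fintype.sum_option]
  simp [weight]

open Classical in
theorem sum_weight_filter (u : Fin m → Circle) (p : Circle) :
    ∑ o with withOne u o = p, weight m l o =
      (if p = 1 then l else 0) + (Finset.univ.filter fun i ↦ u i = p).card := by
  rw [Finset.sum_filter, Fintype.sum_option, Finset.card_filter, Nat.cast_sum]
  congr 1
  · exact if_congr eq_comm rfl rfl
  · refine Finset.sum_congr rfl fun i _ ↦ ?_
    rw [Nat.cast_ite, Nat.cast_one, Nat.cast_zero]
    rfl

open Classical in
theorem mem_stableSet {u : Fin m → Circle} : u ∈ stableSet m l ↔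
    ∀ p, 2 * ((if p = 1 then l else 0) + ((Finset.univ.filter fun i ↦ u i = p).card : ℝ)) <
      l + m := by
  refine forall_congr' fun p ↦ ?_
  rw [sum_weight, ← sum_weight_filter]

open Classical in
theorem card_filter_eq_one {u : Fin m → Circle} (hu : u ∈ stableSet m l) :
    l + 2 * ((Finset.univ.filter fun i ↦ u i = 1).card : ℝ) < m := by
  have := mem_stableSet.1 hu 1
  rw [if_pos rfl] at this
  linarith

theorem exists_embedding_of_le_card {α : Type*} {s : Finset α} {n : ℕ} (h : n ≤ s.card) :
    ∃ σ : Fin n ↪ α, ∀ a, σ a ∈ s := by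
  obtain ⟨t, hts, ht⟩ := Finset.exists_subset_card_eq h
  refine ⟨(t.equivFinOfCardEq ht).symm.toEmbedding.trans (Function.Embedding.subtype _),
    fun a ↦ hts (Subtype.coe_prop _)⟩

open Classical in
theorem exists_of_notMem_stableSet (hm : 6 ≤ m) (hl : 1 ≤ l) {u : Fin m → Circle}
    (hu : u ∉ stableSet m l) : (∃ σ : Fin 4 ↪ Fin m, ∀ a, u (σ a) = u (σ 0)) ∨
      (m : ℝ) - l ≤ 2 * ((Finset.univ.filter fun i ↦ u i = 1).card : ℝ) := by
  rw [mem_stableSet] at hu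
  push Not at hu
  obtain ⟨p, hp⟩ := hu
  by_cases h1 : p = 1
  · subst h1
    rw [if_pos rfl] at hp
    exact Or.inr (by linarith)
  · rw [if_neg h1] at hp
    have hm' : (6 : ℝ) ≤ m := by exact_mod_cast hm
    have h4 : (3 : ℝ) < ((Finset.univ.filter fun i ↦ u i = p).card : ℝ) := by linarith
    obtain ⟨σ, hσ⟩ := exists_embedding_of_le_card (n := 4) (by exact_mod_cast h4)
    have hp' (a) := (Finset.mem_filter.1 (hσ a)).2
    exact Or.inl ⟨σ, fun a ↦ (hp' a).trans (hp' 0).symm⟩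

section Codim

theorem exists_affineSubspace {E F : Type*} [NormedAddCommGroup E] [NormedSpace ℝ E]
    [FiniteDimensional ℝ E] [AddCommGroup F] [Module ℝ F] (f : E →ₗ[ℝ] F)
    (hf : Function.Surjective f) (c : F) : ∃ A : AffineSubspace ℝ E,
      (∀ x, f x = c → x ∈ A) ∧ finrank ℝ A.direction + finrank ℝ F = finrank ℝ E := by
  obtain ⟨p, rfl⟩ := hf c
  refine ⟨AffineSubspace.mk' p f.ker, fun x hx ↦ ?_, ?_⟩
  · rw [AffineSubspace.mem_mk', LinearMap.mem_ker, vsub_eq_sub, map_sub, hx, sub_self]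
  · rw [AffineSubspace.direction_mk', ← f.finrank_range_add_finrank_ker, add_comm,
      LinearMap.range_eq_top.2 hf, finrank_top]

/-- The linear map which compares four coordinates. -/
def coordDiff (σ : Fin 4 ↪ Fin m) : (Fin m → ℝ) →ₗ[ℝ] (Fin 3 → ℝ) :=
  LinearMap.funLeft ℝ ℝ (σ ∘ Fin.succ) - LinearMap.pi fun _ ↦ LinearMap.proj (σ 0)

/-- The linear map which reads three coordinates. -/
def coordMap (σ : Fin 3 ↪ Fin m) : (Fin m → ℝ) →ₗ[ℝ] (Fin 3 → ℝ) :=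
  LinearMap.funLeft ℝ ℝ σ

theorem coordDiff_surjective (σ : Fin 4 ↪ Fin m) : Function.Surjective (coordDiff σ) := by
  intro c
  obtain ⟨x, hx⟩ := σ.injective.surjective_comp_right (Fin.cons (0 : ℝ) c : Fin 4 → ℝ)
  refine ⟨x, funext fun a ↦ ?_⟩
  have hx' (b) : x (σ b) = (Fin.cons (0 : ℝ) c : Fin 4 → ℝ) b := congrFun hx b
  change x (σ a.succ) - x (σ 0) = c a
  rw [hx', hx', Fin.cons_succ, Fin.cons_zero, sub_zero]

theorem coordMap_surjective (σ : Fin 3 ↪ Fin m) : Function.Surjective (coordMap σ) := by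
  intro c
  obtain ⟨x, hx⟩ := σ.injective.surjective_comp_right c
  exact ⟨x, hx⟩

/-- The coordinatewise covering of the torus. -/
noncomputable def expMap (m : ℕ) : (Fin m → ℝ) → Fin m → Circle := Pi.map fun _ ↦ Circle.exp

theorem continuous_expMap : Continuous (expMap m) :=
  Continuous.piMap fun _ ↦ Circle.exp.continuous

theorem isOpenMap_expMap : IsOpenMap (expMap m) :=
  IsOpenMap.piMap (fun _ ↦ Circle.isCoveringMap_exp.isLocalHomeomorph.isOpenMap)
    (Eventually.of_forall fun _ ↦ Circle.exp_surjective)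

/-- A convex open set minus the unstable configurations is simply connected as soon as the latter
have codimension three. -/
theorem isSimplyConnected_inter_preimage (hl : 0 < l) {C : Set (Fin m → ℝ)} (hC : Convex ℝ C)
    (hCo : IsOpen C) (hne : C.Nonempty)
    (h : ∀ θ ∈ C, expMap m θ ∉ stableSet m l →
      (∃ σ : Fin 4 ↪ Fin m, ∀ a, expMap m θ (σ a) = expMap m θ (σ 0)) ∨
        ∃ σ : Fin 3 ↪ Fin m, ∀ a, expMap m θ (σ a) = 1) :
    IsSimplyConnected (C ∩ expMap m ⁻¹' stableSet m l) := by
  choose A hA hA' using fun q : (Fin 4 ↪ Fin m) × (Fin 3 → ℤ) ↦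
    exists_affineSubspace _ (coordDiff_surjective q.1) fun a ↦ q.2 a * (2 * Real.pi)
  choose A₁ hA₁ hA₁' using fun q : (Fin 3 ↪ Fin m) × (Fin 3 → ℤ) ↦
    exists_affineSubspace _ (coordMap_surjective q.1) fun a ↦ q.2 a * (2 * Real.pi)
  refine isSimplyConnected_of_codim_three hC hCo
    (hCo.inter ((isOpen_stableSet hl).preimage continuous_expMap)) hne inter_subset_left
    (Sum.elim A A₁) ?_ ?_
  · rintro (q | q)
    · rw [← hA' q, finrank_fin_fun]
      rfl
    · rw [← hA₁' q, finrank_fin_fun]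
      rfl
  · rintro θ ⟨hθ, hθ'⟩
    rcases h θ hθ fun h' ↦ hθ' ⟨hθ, h'⟩ with ⟨σ, hσ⟩ | ⟨σ, hσ⟩
    · choose k hk using fun a ↦ Circle.exp_eq_exp.1 (hσ a)
      refine mem_iUnion.2 ⟨Sum.inl (σ, fun a ↦ k a.succ), hA _ _ (funext fun a ↦ ?_)⟩
      exact sub_eq_of_eq_add' (hk a.succ)
    · choose k hk using fun a ↦ Circle.exp_eq_one.1 (hσ a)
      exact mem_iUnion.2 ⟨Sum.inr (σ, k), hA₁ _ _ (funext hk)⟩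

/-- The configurations all of whose points lie in given arcs. -/
def arcs (m : ℕ) (l : ℝ) (a b : Fin m → ℝ) : Set (stableSet m l) :=
  {u | ∀ i, u.1 i ∈ Circle.exp '' Ioo (a i) (b i)}

theorem isOpen_arcs (a b : Fin m → ℝ) : IsOpen (arcs m l a b) := by
  have : arcs m l a b =
      ⋂ i, (fun u : stableSet m l ↦ u.1 i) ⁻¹' (Circle.exp '' Ioo (a i) (b i)) := by
    ext u
    rw [mem_iInter]
    rfl
  rw [this]
  exact isOpen_iInter_of_finite fun i ↦
    (Circle.isCoveringMap_exp.isLocalHomeomorph.isOpenMap _ isOpen_Ioo).preimage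
      ((continuous_apply i).comp continuous_subtype_val)

open Classical in
theorem isSimplyConnected_arcs (hm : 6 ≤ m) (hl : 1 ≤ l) {a b : Fin m → ℝ} (hab : ∀ i, a i < b i)
    (hba : ∀ i, b i - a i ≤ 2 * Real.pi)
    (h : ∀ u : Fin m → Circle, (∀ i, u i ∈ Circle.exp '' Ioo (a i) (b i)) →
      l + 2 * ((Finset.univ.filter fun i ↦ u i = 1).card : ℝ) < m) :
    IsSimplyConnected (arcs m l a b) := by
  have hl0 := one_pos.trans_le hl
  have hinj : InjOn (expMap m) (univ.pi fun i ↦ Ioo (a i) (b i)) := fun x hx y hy hxy ↦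
    funext fun i ↦ (Circle.exp_injOn_Ico (hba i)) (Ioo_subset_Ico_self (hx i (mem_univ i)))
      (Ioo_subset_Ico_self (hy i (mem_univ i))) (congrFun hxy i)
  have hopen : IsOpen (univ.pi fun i ↦ Ioo (a i) (b i)) :=
    isOpen_set_pi finite_univ fun i _ ↦ isOpen_Ioo
  rw [← IsEmbedding.subtypeVal.isSimplyConnected_image]
  have himage : Subtype.val '' arcs m l a b =
      expMap m '' ((univ.pi fun i ↦ Ioo (a i) (b i)) ∩ expMap m ⁻¹' stableSet m l) := by
    ext u
    constructor
    · rintro ⟨u, hu, rfl⟩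
      choose θ hθ hθ' using hu
      have : expMap m θ = u.1 := funext hθ'
      exact ⟨θ, ⟨fun i _ ↦ hθ i, by rw [mem_preimage, this]; exact u.2⟩, this⟩
    · rintro ⟨θ, ⟨hθ, hθ'⟩, rfl⟩
      exact ⟨⟨_, hθ'⟩, fun i ↦ ⟨θ i, hθ i (mem_univ i), rfl⟩, rfl⟩
  rw [himage]
  refine isSimplyConnected_image_of_injOn continuous_expMap isOpenMap_expMap hopen hinj
    inter_subset_left (isSimplyConnected_inter_preimage hl0 (convex_pi fun i _ ↦ convex_Ioo _ _)
      hopen (univ_pi_nonempty_iff.2 fun i ↦ nonempty_Ioo.2 (hab i)) fun θ hθ hθ' ↦ ?_)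
  refine Or.inl ((exists_of_notMem_stableSet hm hl hθ').resolve_right fun h' ↦ ?_)
  linarith [h (expMap m θ) fun i ↦ ⟨θ i, hθ i (mem_univ i), rfl⟩]

theorem image_exp_Ioo_zero : Circle.exp '' Ioo 0 (2 * Real.pi) = {1}ᶜ := by
  ext u
  constructor
  · rintro ⟨θ, hθ, rfl⟩ h
    obtain ⟨k, rfl⟩ := Circle.exp_eq_one.1 h
    have := Real.two_pi_pos
    have h1 : (0 : ℝ) < k := pos_of_mul_pos_left hθ.1 this.le
    have h2 : (k : ℝ) < 1 := by nlinarith [hθ.2]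
    norm_cast at h1 h2
    omega
  · intro hu
    have h0 : Complex.arg u ≠ 0 := fun h ↦ hu (Circle.arg_eq_zero.1 h)
    have h1 := Complex.neg_pi_lt_arg u
    have h2 := Complex.arg_le_pi u
    rcases h0.lt_or_gt with h | h
    · exact ⟨Complex.arg u + 2 * Real.pi, ⟨by linarith, by linarith⟩, by
        rw [Circle.exp_add_two_pi, Circle.exp_arg]⟩
    · exact ⟨Complex.arg u, ⟨h, by linarith⟩, Circle.exp_arg u⟩

theorem one_mem_image_exp_Ioo : (1 : Circle) ∈ Circle.exp '' Ioo (-Real.pi) Real.pi :=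
  ⟨0, ⟨neg_lt_zero.2 Real.pi_pos, Real.pi_pos⟩, Circle.exp_zero⟩

theorem image_exp_Ioo_neg_pi_diff_one : Circle.exp '' Ioo (-Real.pi) Real.pi \ {1} =
    Circle.exp '' Ioo 0 Real.pi ∪ Circle.exp '' Ioo (-Real.pi) 0 := by
  have hi : InjOn Circle.exp (Ico (-Real.pi) Real.pi) := Circle.exp_injOn_Ico (by linarith)
  have hs : Ioo (-Real.pi) Real.pi ⊆ Ico (-Real.pi) Real.pi := Ioo_subset_Ico_self
  have hp := Real.pi_pos
  rw [← image_union, ← Circle.exp_zero, ← image_singleton,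
    ← (hi.mono hs).image_sdiff_subset (singleton_subset_iff.2 ⟨neg_lt_zero.2 hp, hp⟩)]
  congr 1
  ext θ
  simp only [Set.mem_sdiff, mem_Ioo, mem_singleton_iff, mem_union]
  constructor
  · rintro ⟨⟨h1, h2⟩, h3⟩
    rcases lt_or_gt_of_ne h3 with h | h
    · exact Or.inr ⟨h1, h⟩
    · exact Or.inl ⟨h, h2⟩
  · rintro (⟨h1, h2⟩ | ⟨h1, h2⟩)
    · exact ⟨⟨by linarith, h2⟩, h1.ne'⟩
    · exact ⟨⟨h1, by linarith⟩, h2.ne⟩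

theorem disjoint_image_exp : Disjoint (Circle.exp '' Ioo 0 Real.pi)
    (Circle.exp '' Ioo (-Real.pi) 0) := by
  have hi : InjOn Circle.exp (Ico (-Real.pi) Real.pi) := Circle.exp_injOn_Ico (by linarith)
  have hp := Real.pi_pos
  refine disjoint_image_image fun x hx y hy h ↦ ?_
  have := hi ⟨by linarith [hx.1], hx.2⟩ ⟨hy.1.le, by linarith [hy.2]⟩ h
  linarith [hx.1, hy.2]

end Codim

section PresentedGroup

variable {ι : Type*} {rels : Set (FreeGroup ι)}

theorem nonempty_presentedGroup_mulEquiv_freeGroup (h : rels = ∅) :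
    Nonempty (FreeGroup ι ≃* PresentedGroup rels) := by
  subst h
  exact ⟨QuotientGroup.quotientBot.symm.trans
    (QuotientGroup.quotientMulEquivOfEq Subgroup.normalClosure_empty.symm)⟩

theorem presentedGroup_subsingleton (h : ∀ i, (PresentedGroup.of i : PresentedGroup rels) = 1) :
    Subsingleton (PresentedGroup rels) := by
  refine subsingleton_of_forall_eq 1 fun x ↦ ?_
  have : MonoidHom.id (PresentedGroup rels) = 1 := PresentedGroup.ext h
  exact DFunLike.congr_fun this x

theorem presentedGroup_commute
    (h : ∀ i j, Commute (PresentedGroup.of i : PresentedGroup rels) (PresentedGroup.of j))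
    (x y : PresentedGroup rels) : x * y = y * x := by
  have h1 (i) (z : PresentedGroup rels) : Commute (PresentedGroup.of i) z := by
    have h2 : Subgroup.closure (range PresentedGroup.of) ≤
        Subgroup.centralizer {(PresentedGroup.of i : PresentedGroup rels)} := by
      rw [Subgroup.closure_le]
      rintro _ ⟨j, rfl⟩
      exact Subgroup.mem_centralizer_singleton_iff.2 (h j i)
    rw [PresentedGroup.closure_range_of] at h2
    exact (Subgroup.mem_centralizer_singleton_iff.1 (h2 (Subgroup.mem_top z))).symm
  have h2 : Subgroup.closure (range PresentedGroup.of) ≤ Subgroup.centralizer {y} := by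
    rw [Subgroup.closure_le]
    rintro _ ⟨j, rfl⟩
    exact Subgroup.mem_centralizer_singleton_iff.2 (h1 j y)
  rw [PresentedGroup.closure_range_of] at h2
  exact Subgroup.mem_centralizer_singleton_iff.1 (h2 (Subgroup.mem_top x))

theorem nonempty_presentedGroup_mulEquiv_multiplicative [Fintype ι] [DecidableEq ι]
    (hrels : ∀ r ∈ rels, FreeGroup.lift
      (fun i ↦ Multiplicative.ofAdd (Pi.single i 1 : ι → ℤ)) r = 1)
    (h : ∀ i j, Commute (PresentedGroup.of i : PresentedGroup rels) (PresentedGroup.of j)) :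
    Nonempty (Multiplicative (ι → ℤ) ≃* PresentedGroup rels) := by
  let : CommGroup (PresentedGroup rels) :=
    { (inferInstance : Group (PresentedGroup rels)) with mul_comm := presentedGroup_commute h }
  let f : Multiplicative (ι → ℤ) →* PresentedGroup rels :=
    { toFun := fun g ↦ ∏ i, PresentedGroup.of i ^ (g.toAdd i)
      map_one' := Finset.prod_eq_one fun i _ ↦ zpow_zero _
      map_mul' := fun g g' ↦ by
        rw [← Finset.prod_mul_distrib]
        exact Finset.prod_congr rfl fun i _ ↦ zpow_add _ _ _ }
  have hf (i) : f (Multiplicative.ofAdd (Pi.single i 1)) = PresentedGroup.of i := by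
    refine (Fintype.prod_eq_single i fun j hj ↦ ?_).trans ?_
    · change _ ^ (Pi.single i 1 : ι → ℤ) j = 1
      rw [Pi.single_eq_of_ne hj, zpow_zero]
    · change _ ^ (Pi.single i 1 : ι → ℤ) i = _
      rw [Pi.single_eq_same, zpow_one]
  have hsum (g : Multiplicative (ι → ℤ)) :
      ∏ i, (Multiplicative.ofAdd (Pi.single i 1 : ι → ℤ)) ^ (g.toAdd i) = g := by
    have : ∑ i, g.toAdd i • (Pi.single i 1 : ι → ℤ) = g.toAdd := by
      funext j
      rw [Finset.sum_apply, Fintype.sum_eq_single j fun i hi ↦ ?_]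
      · simp
      · simp [hi.symm]
    exact this
  refine ⟨MonoidHom.toMulEquiv f (PresentedGroup.toGroup hrels) (MonoidHom.ext fun g ↦ ?_)
    (PresentedGroup.ext fun i ↦ ?_)⟩
  · refine Eq.trans ?_ (hsum g)
    change PresentedGroup.toGroup hrels (∏ i, PresentedGroup.of i ^ (g.toAdd i)) = _
    simp only [map_prod, map_zpow, PresentedGroup.toGroup.of]
  · change f (PresentedGroup.toGroup hrels (PresentedGroup.of i)) = _
    rw [PresentedGroup.toGroup.of]
    exact hf i

end PresentedGroup

theorem HandleCover.pathConnectedSpace {ι X : Type*} [TopologicalSpace X] (H : HandleCover ι X) :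
    PathConnectedSpace X := by
  have hV (α) : IsPathConnected (H.V α) :=
    (H.isSimplyConnected_V α).isPathConnected
  obtain ⟨x₀, hx₀⟩ := (hV none).nonempty
  have h (x : X) : Joined x₀ x := by
    obtain ⟨α, hα⟩ := H.exists_mem x
    cases α with
    | none => exact ((hV none).joinedIn _ hx₀ _ hα).joined
    | some k =>
      exact ((hV none).joinedIn _ hx₀ _ (H.P_subset k (H.pos_mem k)).2).joined.trans
        ((hV (some k)).joinedIn _ (H.P_subset k (H.pos_mem k)).1 _ hα).joined
  exact ⟨⟨x₀⟩, fun x y ↦ (h x).symm.trans (h y)⟩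

/-- The fundamental group of a space with a handle cover is free on the handles. -/
theorem HandleCover.nonempty_mulEquiv {ι X : Type*} [TopologicalSpace X] (H : HandleCover ι X)
    (x : X) : Nonempty (FundamentalGroup X x ≃* FreeGroup ι) := by
  have := H.pathConnectedSpace
  obtain ⟨x₀, hx₀⟩ := (H.isSimplyConnected_V none).isPathConnected.nonempty
  obtain ⟨e⟩ := H.nonempty_mulEquiv_of_mem x₀ hx₀
  exact ⟨(FundamentalGroup.fundamentalGroupMulEquivOfPathConnected x x₀).trans e⟩

section Large

theorem ne_one_of_large {u : Fin m → Circle} (hu : u ∈ stableSet m l) (hl : (m : ℝ) - 2 < l)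
    (i : Fin m) : u i ≠ 1 := by
  classical
  intro hi
  have h1 : 1 ≤ (Finset.univ.filter fun i ↦ u i = 1).card :=
    Finset.card_pos.2 ⟨i, Finset.mem_filter.2 ⟨Finset.mem_univ _, hi⟩⟩
  have h2 : (1 : ℝ) ≤ (Finset.univ.filter fun i ↦ u i = 1).card := by exact_mod_cast h1
  have := card_filter_eq_one hu
  linarith

theorem isSimplyConnected_forall_ne_one (hm : 6 ≤ m) (hl : 1 ≤ l) (hlm : l < m) :
    IsSimplyConnected (arcs m l (fun _ ↦ 0) fun _ ↦ 2 * Real.pi) := by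
  refine isSimplyConnected_arcs hm hl (fun _ ↦ Real.two_pi_pos) (fun _ ↦ by simp) fun u hu ↦ ?_
  rw [image_exp_Ioo_zero] at hu
  classical
  have hu' (i) : u i ≠ 1 := hu i
  rw [Finset.filter_false_of_mem fun i _ ↦ hu' i]
  simpa using hlm

theorem subsingleton_fundamentalGroup (hm : 6 ≤ m) (hl : 1 ≤ l) (hl' : (m : ℝ) - 2 < l)
    (hlm : l < m) (x : stableSet m l) : Subsingleton (FundamentalGroup (stableSet m l) x) := by
  have h := isSimplyConnected_forall_ne_one hm hl hlm
  have : arcs m l (fun _ ↦ 0) (fun _ ↦ 2 * Real.pi) = univ :=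
    eq_univ_of_forall fun u i ↦ by
      rw [image_exp_Ioo_zero]
      exact ne_one_of_large u.2 hl' i
  rw [this] at h
  have : SimplyConnectedSpace (univ : Set (stableSet m l)) := h
  have : SimplyConnectedSpace (stableSet m l) :=
    (Homeomorph.Set.univ _).symm.toHomotopyEquiv.simplyConnectedSpace
  infer_instance

end Large

section Medium

theorem eq_of_eq_one_of_medium {u : Fin m → Circle} (hu : u ∈ stableSet m l)
    (hl : (m : ℝ) - 4 < l) {i j : Fin m} (hi : u i = 1) (hj : u j = 1) : i = j := by
  classical
  have h1 : ((Finset.univ.filter fun i ↦ u i = 1).card : ℝ) < 2 := by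
    linarith [card_filter_eq_one hu]
  have h2 : (Finset.univ.filter fun i ↦ u i = 1).card ≤ 1 :=
    Nat.lt_succ_iff.1 (by exact_mod_cast h1)
  exact Finset.card_le_one.1 h2 i (by simpa using hi) j (by simpa using hj)

/-- The arcs at the index `k` are replaced by a given arc, all others are the complement of one. -/
def arcsAt (l : ℝ) (k : Fin m) (a b : ℝ) : Set (stableSet m l) :=
  arcs m l (Function.update (fun _ ↦ 0) k a) (Function.update (fun _ ↦ 2 * Real.pi) k b)

theorem mem_arcs_iff {u : stableSet m l} :
    u ∈ arcs m l (fun _ ↦ 0) (fun _ ↦ 2 * Real.pi) ↔ ∀ i, u.1 i ≠ 1 :=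
  forall_congr' fun i ↦ by
    rw [image_exp_Ioo_zero]
    rfl

theorem mem_arcsAt_iff {k : Fin m} {a b : ℝ} {u : stableSet m l} :
    u ∈ arcsAt l k a b ↔ u.1 k ∈ Circle.exp '' Ioo a b ∧ ∀ i, i ≠ k → u.1 i ≠ 1 := by
  constructor
  · intro h
    refine ⟨by simpa only [Function.update_self] using h k, fun i hi ↦ ?_⟩
    have := h i
    rw [Function.update_of_ne hi, Function.update_of_ne hi, image_exp_Ioo_zero] at this
    exact this
  · rintro ⟨h1, h2⟩ i
    by_cases hi : i = k
    · subst hi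
      rwa [Function.update_self, Function.update_self]
    · rw [Function.update_of_ne hi, Function.update_of_ne hi, image_exp_Ioo_zero]
      exact h2 i hi

theorem isSimplyConnected_arcsAt (hm : 6 ≤ m) (hl : 1 ≤ l) (hlm : l < m - 2) (k : Fin m) {a b : ℝ}
    (hab : a < b) (hba : b - a ≤ 2 * Real.pi) : IsSimplyConnected (arcsAt l k a b) := by
  classical
  refine isSimplyConnected_arcs hm hl (fun i ↦ ?_) (fun i ↦ ?_) fun u hu ↦ ?_
  · by_cases hi : i = k
    · subst hi
      simpa using hab
    · simpa [Function.update_of_ne hi] using Real.pi_pos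
  · by_cases hi : i = k
    · subst hi
      simpa using hba
    · simp [Function.update_of_ne hi]
  · have h1 : (Finset.univ.filter fun i ↦ u i = 1) ⊆ {k} := fun i hi ↦ by
      rw [Finset.mem_filter] at hi
      rw [Finset.mem_singleton]
      by_contra hik
      have := hu i
      rw [Function.update_of_ne hik, Function.update_of_ne hik, image_exp_Ioo_zero] at this
      exact this hi.2
    have h2 : ((Finset.univ.filter fun i ↦ u i = 1).card : ℝ) ≤ 1 := by
      exact_mod_cast Finset.card_le_card h1
    linarith

/-- The decomposition of the space of stable configurations into a ball and handles. -/
noncomputable def handleCover (hm : 6 ≤ m) (hl : 1 ≤ l) (hl' : (m : ℝ) - 4 < l)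
    (hlm : l < m - 2) : HandleCover (Fin m) (stableSet m l) where
  V α := α.elim (arcs m l (fun _ ↦ 0) fun _ ↦ 2 * Real.pi) fun k ↦ arcsAt l k (-Real.pi) Real.pi
  P k := arcsAt l k 0 Real.pi
  N k := arcsAt l k (-Real.pi) 0
  isOpen_V α := by cases α <;> exact isOpen_arcs _ _
  isOpen_P k := isOpen_arcs _ _
  isOpen_N k := isOpen_arcs _ _
  exists_mem u := by
    by_cases h : ∃ k, u.1 k = 1
    · obtain ⟨k, hk⟩ := h
      refine ⟨some k, mem_arcsAt_iff.2 ⟨hk ▸ one_mem_image_exp_Ioo, fun i hik hi ↦ hik ?_⟩⟩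
      exact eq_of_eq_one_of_medium u.2 hl' hi hk
    · exact ⟨none, mem_arcs_iff.2 fun i hi ↦ h ⟨i, hi⟩⟩
  isSimplyConnected_V α := by
    cases α with
    | none => exact isSimplyConnected_forall_ne_one hm hl (by linarith)
    | some k =>
      exact isSimplyConnected_arcsAt hm hl hlm k (neg_lt_self Real.pi_pos) (by linarith)
  isPathConnected_P k := (isSimplyConnected_arcsAt hm hl hlm k Real.pi_pos
    (by linarith [Real.pi_pos])).isPathConnected
  isPathConnected_N k := (isSimplyConnected_arcsAt hm hl hlm k (neg_lt_zero.2 Real.pi_pos)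
    (by linarith [Real.pi_pos])).isPathConnected
  disjoint k := disjoint_left.2 fun _ h h' ↦
    disjoint_left.1 disjoint_image_exp (mem_arcsAt_iff.1 h).1 (mem_arcsAt_iff.1 h').1
  inter_none k := by
    ext u
    have h := Set.ext_iff.1 image_exp_Ioo_neg_pi_diff_one (u.1 k)
    change u ∈ arcsAt l k _ _ ∧ u ∈ arcs m l _ _ ↔ u ∈ arcsAt l k _ _ ∨ u ∈ arcsAt l k _ _
    rw [mem_arcsAt_iff, mem_arcsAt_iff, mem_arcsAt_iff, mem_arcs_iff, ← or_and_right]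
    change _ ∧ u.1 k ≠ 1 ↔ _ ∨ _ at h
    rw [← h]
    refine ⟨fun h ↦ ⟨⟨h.1.1, h.2 k⟩, h.1.2⟩, fun h ↦ ⟨⟨h.1.1, h.2⟩, fun i ↦ ?_⟩⟩
    by_cases hi : i = k
    · exact hi ▸ h.1.2
    · exact h.2 i hi
  inter_subset k j hkj := by
    rintro u ⟨hk, hj⟩
    refine mem_arcs_iff.2 fun i ↦ ?_
    by_cases hi : i = k
    · exact (mem_arcsAt_iff.1 hj).2 i (hi ▸ hkj)
    · exact (mem_arcsAt_iff.1 hk).2 i hi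

end Medium

section Small

noncomputable instance : AddAction (Fin m → ℤ) (expMap m ⁻¹' stableSet m l) where
  vadd g θ := ⟨fun i ↦ θ.1 i + g i * (2 * Real.pi), by
    have : expMap m (fun i ↦ θ.1 i + g i * (2 * Real.pi)) = expMap m θ.1 :=
      funext fun i ↦ Circle.exp_eq_exp.2 ⟨g i, rfl⟩
    rw [mem_preimage, this]
    exact θ.2⟩
  zero_vadd θ := Subtype.ext (funext fun i ↦ by
    change θ.1 i + ((0 : ℤ) : ℝ) * _ = _
    simp)
  add_vadd g g' θ := Subtype.ext (funext fun i ↦ by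
    change θ.1 i + ((g i + g' i : ℤ) : ℝ) * _ = θ.1 i + g' i * _ + g i * _
    push_cast
    ring)

theorem coe_vadd_apply (g : Fin m → ℤ) (θ : expMap m ⁻¹' stableSet m l) (i : Fin m) :
    (g +ᵥ θ).1 i = θ.1 i + g i * (2 * Real.pi) := rfl

theorem isAddQuotientCoveringMap_expMap :
    IsAddQuotientCoveringMap ((stableSet m l).restrictPreimage (expMap m)) (Fin m → ℤ) where
  toIsQuotientMap := (isOpenMap_expMap.restrictPreimage _).isQuotientMap
    continuous_expMap.restrictPreimage
    (restrictPreimage_surjective _ (Function.Surjective.piMap fun _ ↦ Circle.exp_surjective))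
  continuous_const_vadd g := Continuous.subtype_mk
    ((continuous_subtype_val).add continuous_const) _
  apply_eq_iff_mem_orbit {θ θ'} := by
    constructor
    · intro h
      choose g hg using fun i ↦ Circle.exp_eq_exp.1 (congrFun (congrArg Subtype.val h) i)
      exact ⟨g, Subtype.ext (funext fun i ↦ (hg i).symm)⟩
    · rintro ⟨g, rfl⟩
      exact Subtype.ext (funext fun i ↦ Circle.exp_eq_exp.2 ⟨g i, rfl⟩)
  disjoint θ := by
    refine ⟨{θ' | ∀ i, |θ'.1 i - θ.1 i| < Real.pi}, ?_, ?_⟩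
    · refine eventually_all.2 fun i ↦ ?_
      refine ContinuousAt.eventually_lt ?_ continuousAt_const (by simp [Real.pi_pos])
      exact (((continuous_apply i).comp continuous_subtype_val).sub
        continuous_const).abs.continuousAt
    · rintro g ⟨_, ⟨θ', h1, rfl⟩, h2⟩
      funext i
      have h1 := abs_lt.1 (h1 i)
      have h2 := abs_lt.1 (h2 i)
      simp only [coe_vadd_apply] at h2
      have hp := Real.pi_pos
      have h3 : (g i : ℝ) < 1 := by nlinarith
      have h4 : (-1 : ℝ) < g i := by nlinarith
      norm_cast at h3 h4
      change g i = 0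
      omega

theorem nonempty_fundamentalGroup_mulEquiv_multiplicative (hm : 6 ≤ m) (hl : 1 ≤ l)
    (hlm : l < m - 4) (x : stableSet m l) :
    Nonempty (FundamentalGroup (stableSet m l) x ≃* Multiplicative (Fin m → ℤ)) := by
  classical
  have h := isSimplyConnected_inter_preimage (m := m) (one_pos.trans_le hl) convex_univ
    isOpen_univ univ_nonempty fun θ _ hθ ↦ (exists_of_notMem_stableSet hm hl hθ).imp_right
    fun h ↦ by
      have h3 : (2 : ℝ) < ((Finset.univ.filter fun i ↦ expMap m θ i = 1).card : ℝ) := by linarith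
      obtain ⟨σ, hσ⟩ := exists_embedding_of_le_card (n := 3) (by exact_mod_cast h3)
      exact ⟨σ, fun a ↦ (Finset.mem_filter.1 (hσ a)).2⟩
  rw [univ_inter] at h
  have : SimplyConnectedSpace (expMap m ⁻¹' stableSet m l) := h
  obtain ⟨e, he⟩ := (isAddQuotientCoveringMap_expMap (m := m) (l := l)).surjective x
  exact ⟨(isAddQuotientCoveringMap_expMap.fundamentalGroupEquiv
    (⟨e, he⟩ : (stableSet m l).restrictPreimage (expMap m) ⁻¹' {x})).trans
    MulOpposite.opMulEquiv.symm⟩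

end Small

theorem inv_mul_inv_mul_mul_eq_one_iff {G : Type*} [Group G] {a b : G} :
    a⁻¹ * b⁻¹ * a * b = 1 ↔ Commute a b := by
  rw [← mul_inv_rev, mul_assoc, inv_mul_eq_one]
  exact eq_comm

theorem nonempty_mulEquiv_of_subsingleton {G H : Type*} [Group G] [Group H] [Subsingleton G]
    [Subsingleton H] : Nonempty (G ≃* H) :=
  ⟨{  toFun := 1
      invFun := 1
      left_inv := fun _ ↦ Subsingleton.elim _ _
      right_inv := fun _ ↦ Subsingleton.elim _ _
      map_mul' := fun _ _ ↦ Subsingleton.elim _ _ }⟩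

/-- The side lengths of the polygon. -/
noncomputable abbrev sideLength (m : ℕ) (l : ℝ) (i : Fin (m + 1)) : ℝ :=
  if i = Fin.last m then l else 1

theorem sideLength_last : sideLength m l (Fin.last m) = l := if_pos rfl

theorem sideLength_castSucc (i : Fin m) : sideLength m l i.castSucc = 1 :=
  if_neg (Fin.castSucc_lt_last i).ne

theorem isShort_iff (J : Finset (Fin (m + 1))) :
    IsShort (sideLength m l) J ↔ 2 * ∑ i ∈ J, sideLength m l i < m + l := by
  have h1 : ∑ i, sideLength m l i = m + l := by
    rw [Fin.sum_univ_castSucc, sideLength_last,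
      Finset.sum_congr rfl fun i _ ↦ sideLength_castSucc i]
    simp
  rw [← h1, ← Finset.sum_add_sum_compl J, two_mul]
  exact (add_lt_add_iff_left _).symm

theorem isShort_pair_iff (k : Fin m) :
    IsShort (sideLength m l) {k.castSucc, Fin.last m} ↔ l < m - 2 := by
  rw [isShort_iff, Finset.sum_pair (Fin.castSucc_lt_last k).ne, sideLength_last,
    sideLength_castSucc]
  constructor <;> intro h <;> linarith

theorem isShort_triple_iff {i j : Fin m} (hij : i ≠ j) :
    IsShort (sideLength m l) {i.castSucc, j.castSucc, Fin.last m} ↔ l < m - 4 := by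
  have : i.castSucc ∉ ({j.castSucc, Fin.last m} : Finset (Fin (m + 1))) := by
    simp [hij, (Fin.castSucc_lt_last i).ne]
  rw [isShort_iff, Finset.sum_insert this, Finset.sum_pair (Fin.castSucc_lt_last j).ne,
    sideLength_last, sideLength_castSucc, sideLength_castSucc]
  constructor <;> intro h <;> linarith

theorem two_mul_sum_weight_ne (hgen : ∀ ν : Fin (m + 1) → ℝ, (∀ i, ν i = 1 ∨ ν i = -1) →
    ∑ i, ν i * sideLength m l i ≠ 0) (A : Finset (Option (Fin m))) :
    2 * ∑ o ∈ A, weight m l o ≠ ∑ o, weight m l o := by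
  classical
  intro h
  let s (o : Option (Fin m)) : ℝ := if o ∈ A then 1 else -1
  have hs (o) : s o = 1 ∨ s o = -1 := by
    by_cases ho : o ∈ A
    · exact Or.inl (if_pos ho)
    · exact Or.inr (if_neg ho)
  refine hgen (Fin.lastCases (s none) fun i ↦ s (some i)) (fun i ↦ ?_) ?_
  · induction i using Fin.lastCases with
    | last => simpa only [Fin.lastCases_last] using hs none
    | cast i => simpa only [Fin.lastCases_castSucc] using hs (some i)
  · rw [Fin.sum_univ_castSucc]
    simp only [Fin.lastCases_last, Fin.lastCases_castSucc, sideLength_castSucc, sideLength_last]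
    have h1 : ∑ o, s o * weight m l o = ∑ i, s (some i) * 1 + s none * l := by
      rw [Fintype.sum_option, add_comm]
      rfl
    rw [← h1, ← Finset.sum_add_sum_compl A,
      Finset.sum_congr rfl fun o (ho : o ∈ A) ↦ show s o * weight m l o = weight m l o by
        rw [show s o = 1 from if_pos ho, one_mul],
      Finset.sum_congr rfl fun o (ho : o ∈ Aᶜ) ↦ show s o * weight m l o = -weight m l o by
        rw [show s o = -1 from if_neg (Finset.mem_compl.1 ho), neg_one_mul],
      Finset.sum_neg_distrib]
    rw [← Finset.sum_add_sum_compl A] at h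
    linarith

theorem ne_sub_of_generic (hgen : ∀ A : Finset (Option (Fin m)),
    2 * ∑ o ∈ A, weight m l o ≠ ∑ o, weight m l o) {c : ℕ} (hc : c ≤ m) : l ≠ m - 2 * c := by
  intro h
  obtain ⟨T, -, hT⟩ := Finset.exists_subset_card_eq (s := (Finset.univ : Finset (Fin m))) (n := c)
    (by simpa using hc)
  refine hgen (Finset.insertNone T) ?_
  have h1 : ∑ o ∈ Finset.insertNone T, weight m l o = l + c := by
    rw [Finset.sum_insertNone, ← hT, Finset.card_eq_sum_ones, Nat.cast_sum]
    simp [weight]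
  rw [h1, sum_weight]
  linarith

end PolygonSpace

/-- Farber–Schütz presentation.  Let `n = m + 1 ≥ 7` and consider the
closed planar polygon with side lengths `l_1 = … = l_{n-1} = 1` and `l_n = l`, where
`1 ≤ l < n - 1` and the generic-lengths condition `Σ ν_i l_i ≠ 0` (for all signs `ν_i = ±1`)
holds.  Realize the configuration space as
`M̃ = {u ∈ (S¹)^{n-1} : Σ u_i = -l}`.  Then for every basepoint `x ∈ M̃` the fundamental
group `π₁(M̃, x)` is isomorphic to the group presented on generators `a_1, …, a_{n-1}` with
relators `a_k` whenever `{k, n}` is not short and `a_i⁻¹ a_j⁻¹ a_i a_j` whenever `i ≠ j`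
and `{i, j, n}` is short. -/
theorem fundamentalGroup_polygon_presentation (m : ℕ) (hm : 7 ≤ m + 1)
    (l : ℝ) (hl1 : 1 ≤ l) (hl2 : l < (m : ℝ))
    (hgen : ∀ ν : Fin (m + 1) → ℝ, (∀ i, ν i = 1 ∨ ν i = -1) →
      ∑ i, ν i * (if i = Fin.last m then l else 1) ≠ 0)
    (x : {u : Fin m → ℂ // (∀ i, ‖u i‖ = 1) ∧ ∑ i, u i = -(l : ℂ)}) :
    Nonempty
      (FundamentalGroup {u : Fin m → ℂ // (∀ i, ‖u i‖ = 1) ∧ ∑ i, u i = -(l : ℂ)} x ≃*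
        PresentedGroup {r : FreeGroup (Fin m) |
          (∃ k : Fin m,
            ¬ IsShort (fun i : Fin (m + 1) => if i = Fin.last m then l else 1)
                {k.castSucc, Fin.last m} ∧
            r = FreeGroup.of k) ∨
          (∃ i j : Fin m, i ≠ j ∧
            IsShort (fun i : Fin (m + 1) => if i = Fin.last m then l else 1)
                {i.castSucc, j.castSucc, Fin.last m} ∧
            r = (FreeGroup.of i)⁻¹ * (FreeGroup.of j)⁻¹ * FreeGroup.of i * FreeGroup.of j)}) := by
  have hm6 : 6 ≤ m := by omega
  have hgen' := PolygonSpace.two_mul_sum_weight_ne hgen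
  have h2 : l ≠ m - 2 := by simpa using PolygonSpace.ne_sub_of_generic hgen' (c := 1) (by omega)
  have h4 : l ≠ m - 4 := by
    have := PolygonSpace.ne_sub_of_generic hgen' (c := 2) (by omega)
    norm_num at this
    exact this
  obtain ⟨e⟩ := PolygonSpace.nonempty_homotopyEquiv (zero_lt_one.trans_le hl1) hgen'
  obtain ⟨y, ⟨f⟩⟩ := PolygonSpace.nonempty_fundamentalGroup_mulEquiv e x
  refine Nonempty.map f.trans ?_
  rcases h2.lt_or_gt with h2 | h2
  · rcases h4.lt_or_gt with h4 | h4
    · obtain ⟨g⟩ := PolygonSpace.nonempty_fundamentalGroup_mulEquiv_multiplicative hm6 hl1 h4 y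
      refine Nonempty.map g.trans
        (PolygonSpace.nonempty_presentedGroup_mulEquiv_multiplicative ?_ fun i j ↦ ?_)
      · rintro r (⟨k, hk, -⟩ | ⟨i, j, -, -, rfl⟩)
        · exact absurd ((PolygonSpace.isShort_pair_iff k).2 h2) hk
        · simp only [map_mul, map_inv]
          exact PolygonSpace.inv_mul_inv_mul_mul_eq_one_iff.2 (Commute.all _ _)
      · by_cases hij : i = j
        · exact hij ▸ Commute.refl _
        · refine PolygonSpace.inv_mul_inv_mul_mul_eq_one_iff.1 (PresentedGroup.one_of_mem ?_)
          exact Or.inr ⟨i, j, hij, (PolygonSpace.isShort_triple_iff hij).2 h4, rfl⟩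
    · obtain ⟨g⟩ := (PolygonSpace.handleCover hm6 hl1 h4 h2).nonempty_mulEquiv y
      refine Nonempty.map g.trans (PolygonSpace.nonempty_presentedGroup_mulEquiv_freeGroup ?_)
      refine Set.eq_empty_of_forall_notMem ?_
      rintro r (⟨k, hk, -⟩ | ⟨i, j, hij, h, -⟩)
      · exact hk ((PolygonSpace.isShort_pair_iff k).2 h2)
      · exact h4.not_gt ((PolygonSpace.isShort_triple_iff hij).1 h)
  · have := PolygonSpace.subsingleton_fundamentalGroup hm6 hl1 h2 hl2 y
    refine @PolygonSpace.nonempty_mulEquiv_of_subsingleton _ _ _ _ this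
      (PolygonSpace.presentedGroup_subsingleton fun k ↦ PresentedGroup.one_of_mem ?_)
    exact Or.inl ⟨k, fun h ↦ h2.not_gt ((PolygonSpace.isShort_pair_iff k).1 h), rfl⟩
end

section
/- Let n ≥ 7 be an odd integer and consider the closed planar equilateral polygon with n sides of length 1. Realize its configuration space (modulo orientation-preserving isometries of the plane) as the subspace M̃ = {u ∈ (S¹)^{n−1} : Σ_{i=1}^{n−1} u_i = −1} of the (n−1)-torus, where S¹ is the unit circle in ℂ. Then for every basepoint x ∈ M̃, the fundamental group π_1(M̃, x) is abelian. -/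
open Set Filter Topology unitInterval

section SimplyConnected

variable {E : Type*} [NormedAddCommGroup E] [NormedSpace ℝ E]

/-- Two paths in `U` with common endpoints and both contained in a convex subset of `U` are
homotopic in `U`. -/
theorem Path.homotopic_of_mem_convex {U C : Set E} (hC : Convex ℝ C) (hCU : C ⊆ U) {a b : U}
    (p q : Path a b) (hp : ∀ t, (p t : E) ∈ C) (hq : ∀ t, (q t : E) ∈ C) : p.Homotopic q := by
  refine ⟨⟨⟨⟨fun s => ⟨(1 - (s.1 : ℝ)) • (p s.2 : E) + (s.1 : ℝ) • (q s.2 : E), hCU ?_⟩, ?_⟩,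
    ?_, ?_⟩, ?_⟩⟩
  · exact hC (hp _) (hq _) (by linarith [s.1.2.2]) s.1.2.1 (by ring)
  · exact Continuous.subtype_mk (by fun_prop) _
  · intro t; ext; simp
  · intro t; ext; simp
  · rintro s t (rfl | rfl)
    · ext; simp [← add_smul]
    · ext; simp [← add_smul]

/-- A path in an open set can be subdivided into finitely many pieces, each of which stays in a
convex subset. -/
theorem Path.exists_subdivision_convex {U : Set E} (hU : IsOpen U) {a b : U} (γ : Path a b) :
    ∃ t : ℕ → I, t 0 = 0 ∧ Monotone t ∧ (∃ n, ∀ k ≥ n, t k = 1) ∧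
      ∀ n, ∃ C ⊆ U, Convex ℝ C ∧ ∀ s ∈ Icc (t n) (t (n + 1)), (γ s : E) ∈ C := by
  obtain ⟨t, h0, hm, h1, ht⟩ := exists_monotone_Icc_subset_open_cover_unitInterval
    (ι := {C : Set E // C ⊆ U ∧ Convex ℝ C ∧ IsOpen C}) (c := fun C => (fun s => (γ s : E)) ⁻¹' C.1)
    (fun C => C.2.2.2.preimage (by fun_prop)) (fun s _ => by
      obtain ⟨r, hr, hrU⟩ := Metric.isOpen_iff.1 hU _ (γ s).2
      exact mem_iUnion.2 ⟨⟨Metric.ball (γ s : E) r, hrU, convex_ball _ _, Metric.isOpen_ball⟩,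
        Metric.mem_ball_self hr⟩)
  refine ⟨t, h0, hm, h1, fun n => ?_⟩
  obtain ⟨C, hC⟩ := ht n
  exact ⟨C.1, C.2.1, C.2.2.1, fun s hs => hC hs⟩

/-- If all triangles with apex `P` over segments in `U` between vertices in `V` lie in `U`, a path
subdivided at points of `V` is homotopic to the path through `P`. -/
theorem Path.homotopic_cone {U V : Set E} {P : U}
    (hV : ∀ a ∈ V, ∀ b ∈ V, segment ℝ a b ⊆ U → convexHull ℝ {(P : E), a, b} ⊆ U)
    (c : ∀ v : U, (v : E) ∈ V → Path v P)
    (hc : ∀ (v : U) hv t, (c v hv t : E) ∈ segment ℝ (P : E) v)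
    {a b : U} (γ : Path a b) {t : ℕ → I} (h0 : t 0 = 0) (hm : Monotone t)
    (h1 : ∃ n, ∀ k ≥ n, t k = 1)
    (ht : ∀ n, ∃ C ⊆ U, Convex ℝ C ∧ ∀ s ∈ Icc (t n) (t (n + 1)), (γ s : E) ∈ C)
    (htV : ∀ n, (γ (t n) : E) ∈ V) (ha : (a : E) ∈ V) (hb : (b : E) ∈ V) :
    γ.Homotopic ((c a ha).trans (c b hb).symm) := by
  have step : ∀ n, (γ.subpath (t n) (t (n + 1))).Homotopic
      ((c _ (htV n)).trans (c _ (htV (n + 1))).symm) := by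
    intro n
    obtain ⟨C, hCU, hC, hγC⟩ := ht n
    have hle : t n ≤ t (n + 1) := hm n.le_succ
    have h1 := hγC _ (left_mem_Icc.2 hle)
    have h2 := hγC _ (right_mem_Icc.2 hle)
    have hseg : segment ℝ (γ (t n) : E) (γ (t (n + 1))) ⊆ C := hC.segment_subset h1 h2
    have hsegU := hseg.trans hCU
    let s : Path (γ (t n)) (γ (t (n + 1))) :=
      { toFun := fun r => ⟨AffineMap.lineMap (γ (t n) : E) (γ (t (n + 1)) : E) (r : ℝ),
          hsegU (by rw [segment_eq_image_lineMap]; exact ⟨r, r.2, rfl⟩)⟩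
        continuous_toFun := Continuous.subtype_mk (by fun_prop) _
        source' := by ext; simp
        target' := by ext; simp }
    have hs : ∀ r, (s r : E) ∈ segment ℝ (γ (t n) : E) (γ (t (n + 1))) := fun r => by
      rw [segment_eq_image_lineMap]; exact ⟨r, r.2, rfl⟩
    refine (Path.homotopic_of_mem_convex hC hCU _ s ?_ fun r => hseg (hs r)).trans
      (Path.homotopic_of_mem_convex (convex_convexHull ℝ _)
        (hV _ (htV n) _ (htV (n + 1)) hsegU) _ _ ?_ ?_)
    · intro r
      refine hγC _ ?_
      rw [← uIcc_of_le hle, ← range_subpathAux]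
      exact ⟨r, rfl⟩
    · intro r
      have := hs r
      rw [← convexHull_pair] at this
      exact convexHull_mono (by simp) this
    · intro r
      have key : ∀ v hv r, v ∈ ({γ (t n), γ (t (n + 1))} : Set U) →
          (c v hv r : E) ∈ convexHull ℝ {(P : E), (γ (t n) : E), (γ (t (n + 1)) : E)} := by
        intro v hv r h
        have := hc v hv r
        rw [← convexHull_pair] at this
        refine convexHull_mono ?_ this
        rcases h with rfl | rfl <;> grind
      have hr := mem_range_self (f := (c _ (htV n)).trans (c _ (htV (n + 1))).symm) r
      rw [Path.trans_range, Path.symm_range] at hr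
      rcases hr with ⟨r', h⟩ | ⟨r', h⟩
      · rw [← h]; exact key _ _ _ (by simp)
      · rw [← h]; exact key _ _ _ (by simp)
  have main : ∀ n, (γ.subpath (t 0) (t n)).Homotopic
      ((c _ (htV 0)).trans (c _ (htV n)).symm) := by
    intro n
    induction n with
    | zero =>
      rw [Path.subpath_self]
      exact ⟨Path.Homotopy.reflTransSymm _⟩
    | succ n ih =>
      refine (Path.Homotopic.symm ⟨Path.Homotopy.subpathTransSubpath γ (t 0) (t n) _⟩).trans
        ((ih.hcomp (step n)).trans ?_)
      rw [← Path.Homotopic.Quotient.eq]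
      simp only [Path.Homotopic.Quotient.mk_trans, Path.Homotopic.Quotient.mk_symm]
      rw [Path.Homotopic.Quotient.trans_assoc, ← Path.Homotopic.Quotient.trans_assoc _ _
        (Path.Homotopic.Quotient.symm _), Path.Homotopic.Quotient.symm_trans,
        Path.Homotopic.Quotient.refl_trans]
  have transport : ∀ (a' b' : U) (p : Path a' b') (ha' : (a' : E) ∈ V) (hb' : (b' : E) ∈ V)
      (h : a = a') (h' : b = b'), p.Homotopic ((c a' ha').trans (c b' hb').symm) →
      (p.cast h h').Homotopic ((c a ha).trans (c b hb).symm) := by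
    rintro _ _ p _ _ rfl rfl h
    exact h
  obtain ⟨n, hn⟩ := h1
  have hγ : γ = (γ.subpath (t 0) (t n)).cast (by simp [h0]) (by simp [hn n le_rfl]) := by
    ext r
    simp [Path.subpath, h0, hn n le_rfl]
  rw [hγ]
  exact transport _ _ _ _ _ _ _ (main n)

/-- An open subset in which every countable set of vertices admits a cone point is simply
connected, in the sense that paths with the same endpoints are homotopic. -/
theorem Path.homotopic_of_exists_cone {U : Set E} (hU : IsOpen U)
    (hcone : ∀ V : Set E, V.Countable → ∃ P ∈ U, ∀ a ∈ V, ∀ b ∈ V, segment ℝ a b ⊆ U →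
      convexHull ℝ {P, a, b} ⊆ U) {a b : U} (γ δ : Path a b) : γ.Homotopic δ := by
  obtain ⟨t, h0, hm, h1, ht⟩ := γ.exists_subdivision_convex hU
  obtain ⟨t', h0', hm', h1', ht'⟩ := δ.exists_subdivision_convex hU
  obtain ⟨P, hP, hV⟩ := hcone ({(a : E), (b : E)} ∪
    (range (fun n => (γ (t n) : E)) ∪ range (fun n => (δ (t' n) : E))))
    ((Set.toFinite _).countable.union ((countable_range _).union (countable_range _)))
  set V := ({(a : E), (b : E)} ∪
    (range (fun n => (γ (t n) : E)) ∪ range (fun n => (δ (t' n) : E))))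
  have hc : ∀ v : U, (v : E) ∈ V → ∃ c : Path v ⟨P, hP⟩, ∀ t, (c t : E) ∈ segment ℝ P v := by
    intro v hv
    have hmem : ∀ r : I, AffineMap.lineMap (v : E) P (r : ℝ) ∈ segment ℝ P v := fun r => by
      rw [segment_symm, segment_eq_image_lineMap]; exact ⟨r, r.2, rfl⟩
    have hsub : segment ℝ P v ⊆ U := by
      have := hV v hv v hv (by simp)
      rwa [Set.pair_eq_singleton, convexHull_pair] at this
    exact ⟨{ toFun := fun r => ⟨AffineMap.lineMap (v : E) P (r : ℝ), hsub (hmem r)⟩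
             continuous_toFun := Continuous.subtype_mk (by fun_prop) _
             source' := by ext; simp
             target' := by ext; simp }, hmem⟩
  choose c hc using hc
  have ha : (a : E) ∈ V := by simp [V]
  have hb : (b : E) ∈ V := by simp [V]
  exact (Path.homotopic_cone (P := ⟨P, hP⟩) hV c hc γ h0 hm h1 ht
    (fun n => Or.inr (Or.inl ⟨n, rfl⟩)) ha hb).trans
    (Path.homotopic_cone (P := ⟨P, hP⟩) hV c hc δ h0' hm' h1' ht'
    (fun n => Or.inr (Or.inr ⟨n, rfl⟩)) ha hb).symm

end SimplyConnected

section Stable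

variable {ι : Type*}

/-- The universal covering of the torus. -/
noncomputable def torusExp (θ : ι → ℝ) (i : ι) : ℂ := Circle.exp (θ i)

theorem continuous_torusExp : Continuous (torusExp : (ι → ℝ) → ι → ℂ) := by
  unfold torusExp
  fun_prop

theorem norm_torusExp (θ : ι → ℝ) (i : ι) : ‖torusExp θ i‖ = 1 := Circle.norm_coe _

/-- The affine function vanishing on a linear combination of coincidence conditions. -/
def coincidenceFun (c : Fin 3 → ℝ) (i : Fin 4 ↪ ι) (d : Fin 3 → ℝ) (θ : ι → ℝ) : ℝ :=
  ∑ l, c l * (θ (i l.succ) - θ (i 0) - d l)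

theorem coincidenceFun_combination (c : Fin 3 → ℝ) (i : Fin 4 ↪ ι) (d : Fin 3 → ℝ)
    (x y : ι → ℝ) {s t : ℝ} (hst : s + t = 1) :
    coincidenceFun c i d (s • x + t • y) =
      s * coincidenceFun c i d x + t * coincidenceFun c i d y := by
  obtain rfl : s = 1 - t := by linarith
  simp only [coincidenceFun, Fin.sum_univ_three, Pi.add_apply, Pi.smul_apply, smul_eq_mul]
  ring

theorem exists_coincidenceFun_eq_zero (i : Fin 4 ↪ ι) (d : Fin 3 → ℝ) (a b : ι → ℝ) :
    ∃ c : Fin 3 → ℝ, c ≠ 0 ∧ coincidenceFun c i d a = 0 ∧ coincidenceFun c i d b = 0 := by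
  let f : (Fin 3 → ℝ) →ₗ[ℝ] ℝ × ℝ :=
    { toFun := fun c => (coincidenceFun c i d a, coincidenceFun c i d b)
      map_add' := fun x y => by simp [coincidenceFun, add_mul, Finset.sum_add_distrib]
      map_smul' := fun r x => by simp [coincidenceFun, mul_assoc, Finset.mul_sum] }
  have hf : LinearMap.ker f ≠ ⊥ := f.ker_ne_bot_of_finrank_lt (by simp)
  obtain ⟨c, hc, hc0⟩ := (Submodule.ne_bot_iff _).1 hf
  have : f c = 0 := hc
  exact ⟨c, hc0, congrArg Prod.fst this, congrArg Prod.snd this⟩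

variable [Fintype ι]

/-- A configuration of points on the unit circle is stable if fewer than half of the points
coincide. -/
def StableConfig (u : ι → ℂ) : Prop :=
  (∀ i, ‖u i‖ = 1) ∧ ∀ j, 2 * Nat.card {i // u i = u j} < Fintype.card ι

theorem eventually_stableConfig {u : ι → ℂ} (hu : StableConfig u) :
    ∀ᶠ v in 𝓝 u, (∀ i, ‖v i‖ = 1) → StableConfig v := by
  have h : ∀ᶠ v in 𝓝 u, ∀ i j, v i = v j → u i = u j := by
    refine eventually_all.2 fun i => eventually_all.2 fun j => ?_
    by_cases hij : u i = u j
    · simp [hij]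
    · have : IsOpen {v : ι → ℂ | v i ≠ v j} :=
        isOpen_ne_fun (continuous_apply i) (continuous_apply j)
      filter_upwards [this.mem_nhds hij] with v hv h
      exact absurd h hv
  filter_upwards [h] with v hv hn
  refine ⟨hn, fun j => lt_of_le_of_lt ?_ (hu.2 j)⟩
  exact Nat.mul_le_mul_left 2 (Nat.card_le_card_of_injective
    (fun i : {i // v i = v j} => (⟨i.1, hv _ _ i.2⟩ : {i // u i = u j}))
    (fun a b h => Subtype.ext (congrArg (fun z => z.1) h)))

theorem isOpen_stableConfig_torusExp : IsOpen {θ : ι → ℝ | StableConfig (torusExp θ)} := by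
  refine isOpen_iff_mem_nhds.2 fun θ hθ => ?_
  filter_upwards [continuous_torusExp.continuousAt.eventually (eventually_stableConfig hθ)] with v hv
  exact hv (norm_torusExp v)

theorem exists_four_of_not_stableConfig (hι : 7 ≤ Fintype.card ι) {θ : ι → ℝ}
    (h : ¬ StableConfig (torusExp θ)) : ∃ i : Fin 4 ↪ ι, ∃ k : Fin 3 → ℤ,
      ∀ l : Fin 3, θ (i l.succ) - θ (i 0) = k l * (2 * Real.pi) := by
  simp only [StableConfig, norm_torusExp, implies_true, true_and, not_forall, not_lt] at h
  obtain ⟨j, hj⟩ := h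
  rw [Nat.card_eq_fintype_card] at hj
  obtain ⟨e⟩ := Function.Embedding.nonempty_of_card_le
    (show Fintype.card (Fin 4) ≤ Fintype.card {i // torusExp θ i = torusExp θ j} by
      rw [Fintype.card_fin]; omega)
  have key : ∀ l : Fin 3, ∃ k : ℤ, θ (e l.succ) - θ (e 0) = k * (2 * Real.pi) := by
    intro l
    have h := (e l.succ).2.trans (e 0).2.symm
    simp only [torusExp, Circle.coe_inj, Circle.exp_eq_exp] at h
    obtain ⟨m, hm⟩ := h
    exact ⟨m, sub_eq_of_eq_add' hm⟩
  choose k hk using key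
  exact ⟨e.trans (Function.Embedding.subtype _), k, hk⟩

open MeasureTheory in
theorem volume_coincidenceFun_eq_zero {c : Fin 3 → ℝ} (hc : c ≠ 0) (i : Fin 4 ↪ ι)
    (d : Fin 3 → ℝ) : volume {θ : ι → ℝ | coincidenceFun c i d θ = 0} = 0 := by
  classical
  let A : AffineSubspace ℝ (ι → ℝ) :=
    { carrier := {θ | coincidenceFun c i d θ = 0}
      smul_vsub_vadd_mem' := by
        intro r x y z hx hy hz
        simp only [mem_ofPred_eq, coincidenceFun, Fin.sum_univ_three, vsub_eq_sub, vadd_eq_add,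
          Pi.add_apply, Pi.smul_apply, Pi.sub_apply, smul_eq_mul] at *
        linear_combination r * hx - r * hy + hz }
  refine Measure.addHaar_affineSubspace volume A fun hA => ?_
  obtain ⟨l, hl⟩ := Function.ne_iff.1 hc
  have hmem : ∀ θ, coincidenceFun c i d θ = 0 := fun θ => by
    have : θ ∈ A := hA ▸ AffineSubspace.mem_top ℝ _ θ
    exact this
  have h0 := hmem 0
  have h1 := hmem (Pi.single (i l.succ) 1)
  apply hl
  have h2 : coincidenceFun c i d (Pi.single (i l.succ) 1) - coincidenceFun c i d 0 = c l := by
    rw [coincidenceFun, coincidenceFun, ← Finset.sum_sub_distrib, Finset.sum_eq_single l]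
    · simp [(Fin.succ_ne_zero l).symm]
      ring
    · intro l' _ h
      simp [h, (Fin.succ_ne_zero l).symm]
    · simp
  rw [← h2, h0, h1, sub_zero, Pi.zero_apply]

open MeasureTheory in
theorem exists_generic_point {V : Set (ι → ℝ)} (hV : V.Countable) :
    ∃ P : ι → ℝ, ∀ a ∈ V, ∀ b ∈ V, ∀ (i : Fin 4 ↪ ι) (k : Fin 3 → ℤ), ∃ c,
      coincidenceFun c i (fun l => k l * (2 * Real.pi)) a = 0 ∧
      coincidenceFun c i (fun l => k l * (2 * Real.pi)) b = 0 ∧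
      coincidenceFun c i (fun l => k l * (2 * Real.pi)) P ≠ 0 := by
  choose c hc0 hca hcb using fun (i : Fin 4 ↪ ι) (d : Fin 3 → ℝ) (a b : ι → ℝ) =>
    exists_coincidenceFun_eq_zero i d a b
  have hae : ∀ᵐ P : ι → ℝ, ∀ a ∈ V, ∀ b ∈ V, ∀ (i : Fin 4 ↪ ι) (k : Fin 3 → ℤ),
      coincidenceFun (c i (fun l => k l * (2 * Real.pi)) a b) i
        (fun l => k l * (2 * Real.pi)) P ≠ 0 := by
    refine (ae_ball_iff hV).2 fun a _ => (ae_ball_iff hV).2 fun b _ => ae_all_iff.2 fun i =>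
      ae_all_iff.2 fun k => ?_
    rw [ae_iff]
    simpa using volume_coincidenceFun_eq_zero (hc0 i _ a b) i (fun l => k l * (2 * Real.pi))
  obtain ⟨P, hP⟩ := hae.exists
  exact ⟨P, fun a ha b hb i k => ⟨_, hca _ _ _ _, hcb _ _ _ _, hP a ha b hb i k⟩⟩

theorem exists_cone_point_stableConfig (hι : 7 ≤ Fintype.card ι) {V : Set (ι → ℝ)}
    (hV : V.Countable) : ∃ P ∈ {θ : ι → ℝ | StableConfig (torusExp θ)}, ∀ a ∈ V, ∀ b ∈ V,
      segment ℝ a b ⊆ {θ : ι → ℝ | StableConfig (torusExp θ)} →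
      convexHull ℝ {P, a, b} ⊆ {θ : ι → ℝ | StableConfig (torusExp θ)} := by
  obtain ⟨P, hP⟩ := exists_generic_point (hV.insert 0)
  have vanish : ∀ (c : Fin 3 → ℝ) (i : Fin 4 ↪ ι) (d : Fin 3 → ℝ) (θ : ι → ℝ),
      (∀ l : Fin 3, θ (i l.succ) - θ (i 0) = d l) → coincidenceFun c i d θ = 0 :=
    fun c i d θ h => by simp [coincidenceFun, h]
  refine ⟨P, ?_, fun a ha b hb hab x hx => ?_⟩
  · by_contra h
    obtain ⟨i, k, hk⟩ := exists_four_of_not_stableConfig hι h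
    obtain ⟨c, -, -, hc⟩ := hP 0 (by simp) 0 (by simp) i k
    exact hc (vanish _ _ _ _ hk)
  · by_contra h
    obtain ⟨i, k, hk⟩ := exists_four_of_not_stableConfig hι h
    obtain ⟨c, hca, hcb, hcP⟩ := hP a (by simp [ha]) b (by simp [hb]) i k
    have hx0 := vanish c _ _ _ hk
    rw [convexHull_insert (by simp), convexHull_pair, mem_convexJoin] at hx
    obtain ⟨_, rfl, q, hq, s, t, hs, ht, hst, rfl⟩ := hx
    obtain ⟨s', t', -, -, hst', hq'⟩ := id hq
    have hq0 := coincidenceFun_combination c i (fun l => k l * (2 * Real.pi)) a b hst'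
    rw [hq', hca, hcb] at hq0
    rw [coincidenceFun_combination _ _ _ _ _ hst, hq0] at hx0
    have hs0 : s = 0 := by simpa [hcP] using hx0
    obtain rfl : t = 1 := by linarith
    apply h
    simpa [hs0] using hab hq

end Stable

section Barycenter

open ComplexConjugate

/-- The Möbius transformation of the unit disc sending `w` to `0`. -/
noncomputable def discMoebius (w u : ℂ) : ℂ := (u - w) / (1 - conj w * u)

theorem one_sub_conj_mul_ne_zero {w u : ℂ} (hw : ‖w‖ < 1) (hu : ‖u‖ ≤ 1) :
    1 - conj w * u ≠ 0 := by
  intro h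
  have h1 : ‖conj w * u‖ = 1 := by rw [← sub_eq_zero.1 h, norm_one]
  rw [norm_mul, RCLike.norm_conj] at h1
  nlinarith [norm_nonneg w, norm_nonneg u]

theorem mul_conj_eq_one {u : ℂ} (hu : ‖u‖ = 1) : u * conj u = 1 := by
  rw [Complex.mul_conj']; simp [hu]

theorem norm_discMoebius {w u : ℂ} (hw : ‖w‖ < 1) (hu : ‖u‖ = 1) : ‖discMoebius w u‖ = 1 := by
  have h : u - w = u * conj (1 - conj w * u) := by
    simp only [map_sub, map_one, map_mul, Complex.conj_conj]
    linear_combination w * mul_conj_eq_one hu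
  rw [discMoebius, h, norm_div, norm_mul, hu, RCLike.norm_conj, one_mul,
    div_self (norm_ne_zero_iff.2 (one_sub_conj_mul_ne_zero hw hu.le))]

theorem discMoebius_zero_left (u : ℂ) : discMoebius 0 u = u := by simp [discMoebius]

theorem discMoebius_injective {w u v : ℂ} (hw : ‖w‖ < 1) (hu : ‖u‖ = 1) (hv : ‖v‖ = 1)
    (h : discMoebius w u = discMoebius w v) : u = v := by
  rw [discMoebius, discMoebius, div_eq_div_iff (one_sub_conj_mul_ne_zero hw hu.le)
    (one_sub_conj_mul_ne_zero hw hv.le)] at h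
  have h1 : (1 - conj w * w) * (u - v) = 0 := by linear_combination h
  rcases mul_eq_zero.1 h1 with h1 | h1
  · exact absurd h1 (one_sub_conj_mul_ne_zero hw hw.le)
  · exact sub_eq_zero.1 h1

theorem discMoebius_comp {w w' u : ℂ} (hw : ‖w‖ < 1) (hw' : ‖w'‖ < 1) (hu : ‖u‖ = 1) :
    (1 - conj w' * w) * discMoebius w' u =
      (1 - conj w * w') * discMoebius (discMoebius w w') (discMoebius w u) := by
  have h1 := one_sub_conj_mul_ne_zero hw hu.le
  have h2 := one_sub_conj_mul_ne_zero hw' hu.le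
  have h3 := one_sub_conj_mul_ne_zero hw hw'.le
  have h4 := one_sub_conj_mul_ne_zero hw' hw.le
  have h5 := one_sub_conj_mul_ne_zero hw hw.le
  have h1' : 1 - u * conj w ≠ 0 := by rwa [mul_comm]
  have h2' : 1 - u * conj w' ≠ 0 := by rwa [mul_comm]
  have h3' : 1 - w' * conj w ≠ 0 := by rwa [mul_comm]
  have h4' : 1 - w * conj w' ≠ 0 := by rwa [mul_comm]
  have h5' : 1 - w * conj w ≠ 0 := by rwa [mul_comm]
  have hnum : discMoebius w u - discMoebius w w' =
      (1 - conj w * w) * (u - w') / ((1 - conj w * u) * (1 - conj w * w')) := by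
    rw [discMoebius, discMoebius]; field_simp; ring
  have hden : 1 - conj (discMoebius w w') * discMoebius w u =
      (1 - conj w * w) * (1 - conj w' * u) / ((1 - conj w * u) * (1 - conj w' * w)) := by
    rw [discMoebius, discMoebius]
    simp only [map_div₀, map_sub, map_mul, map_one, Complex.conj_conj]
    field_simp; ring
  rw [show discMoebius (discMoebius w w') (discMoebius w u) = _ / _ from rfl, hnum, hden,
    discMoebius]
  field_simp

theorem re_conj_mul_discMoebius_sub {z v : ℂ} (hz : ‖z‖ < 1) (hv : ‖v‖ = 1) :
    (conj z * (discMoebius z v - v)).re =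
      -(2 * (conj z * v).im ^ 2 / Complex.normSq (1 - conj z * v)) := by
  have h1 := one_sub_conj_mul_ne_zero hz hv.le
  have hq : conj z * z = (conj z * v) * conj (conj z * v) := by
    simp only [map_mul, Complex.conj_conj]
    linear_combination (-conj z * z) * mul_conj_eq_one hv
  have h : conj z * (discMoebius z v - v) =
      ((conj z * v) * (conj z * v - conj (conj z * v))) / (1 - conj z * v) := by
    rw [discMoebius, eq_div_iff h1, mul_sub (conj z * v), ← hq]
    field_simp
    ring
  rw [h]
  set q := conj z * v
  rw [Complex.div_re]
  simp only [Complex.mul_re, Complex.mul_im, Complex.sub_re, Complex.sub_im, Complex.conj_re,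
    Complex.conj_im, Complex.one_re, Complex.one_im]
  ring

variable {ι : Type*} [Fintype ι]

/-- The sum of the images of a configuration under a Möbius transformation; its zeros `w` are the
conformal barycenters of the configuration. -/
noncomputable def moebiusSum (u : ι → ℂ) (w : ℂ) : ℂ := ∑ i, discMoebius w (u i)

theorem StableConfig.card_lt [Nonempty ι] {u : ι → ℂ} (hu : StableConfig u) (ζ : ℂ) :
    2 * Nat.card {i // u i = ζ} < Fintype.card ι := by
  by_cases h : ∃ j, u j = ζ
  · obtain ⟨j, rfl⟩ := h
    exact hu.2 j
  · have : IsEmpty {i // u i = ζ} := ⟨fun i => h ⟨i.1, i.2⟩⟩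
    simp [Fintype.card_pos]

theorem StableConfig.exists_ne [Nonempty ι] {u : ι → ℂ} (hu : StableConfig u) (ζ ξ : ℂ) :
    ∃ i, u i ≠ ζ ∧ u i ≠ ξ := by
  classical
  by_contra! h
  have h1 := hu.card_lt ζ
  have h2 := hu.card_lt ξ
  rw [Nat.card_eq_fintype_card] at h1 h2
  have h3 : Fintype.card ι ≤ Fintype.card ({i // u i = ζ} ⊕ {i // u i = ξ}) :=
    Fintype.card_le_of_injective
      (fun i => if hi : u i = ζ then Sum.inl ⟨i, hi⟩ else Sum.inr ⟨i, h i hi⟩) (by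
        intro i j hij
        simp only at hij
        split_ifs at hij <;> simpa using hij)
  rw [Fintype.card_sum] at h3
  omega

theorem StableConfig.moebiusSum_unique [Nonempty ι] {u : ι → ℂ} (hu : StableConfig u) {w w' : ℂ}
    (hw : ‖w‖ < 1) (hw' : ‖w'‖ < 1) (h : moebiusSum u w = 0) (h' : moebiusSum u w' = 0) :
    w = w' := by
  set z := discMoebius w w' with hz
  have h4 := one_sub_conj_mul_ne_zero hw hw'.le
  by_cases hz0 : z = 0
  · rw [hz, discMoebius, div_eq_zero_iff] at hz0
    rcases hz0 with h0 | h0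
    · exact (sub_eq_zero.1 h0).symm
    · exact absurd h0 h4
  exfalso
  have hz1 : ‖z‖ < 1 := by
    have h5 : Complex.normSq (1 - conj w * w') - Complex.normSq (w' - w) =
        (1 - Complex.normSq w) * (1 - Complex.normSq w') := by
      simp only [Complex.normSq_apply, Complex.sub_re, Complex.sub_im, Complex.mul_re,
        Complex.mul_im, Complex.conj_re, Complex.conj_im, Complex.one_re, Complex.one_im]
      ring
    rw [Complex.normSq_eq_norm_sq, Complex.normSq_eq_norm_sq, Complex.normSq_eq_norm_sq,
      Complex.normSq_eq_norm_sq] at h5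
    rw [hz, discMoebius, norm_div, div_lt_one (norm_pos_iff.2 h4)]
    refine lt_of_pow_lt_pow_left₀ 2 (norm_nonneg _) ?_
    have : 0 < (1 - ‖w‖ ^ 2) * (1 - ‖w'‖ ^ 2) := by
      apply mul_pos <;> nlinarith [norm_nonneg w, norm_nonneg w']
    linarith
  have hv : ∀ i, ‖discMoebius w (u i)‖ = 1 := fun i => norm_discMoebius hw (hu.1 i)
  have hsum : ∑ i, discMoebius z (discMoebius w (u i)) = 0 := by
    have : (1 - conj w * w') * ∑ i, discMoebius z (discMoebius w (u i)) = 0 := by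
      rw [Finset.mul_sum, ← Finset.sum_congr rfl fun i _ => discMoebius_comp hw hw' (hu.1 i),
        ← Finset.mul_sum]
      exact mul_eq_zero_of_right _ h'
    exact (mul_eq_zero.1 this).resolve_left h4
  have hre : ∑ i, 2 * (conj z * discMoebius w (u i)).im ^ 2 /
      Complex.normSq (1 - conj z * discMoebius w (u i)) = 0 := by
    rw [← neg_eq_zero, ← Finset.sum_neg_distrib,
      ← Finset.sum_congr rfl fun i _ => re_conj_mul_discMoebius_sub hz1 (hv i),
      ← Complex.re_sum, ← Finset.mul_sum, Finset.sum_sub_distrib, hsum]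
    simp [show ∑ i, discMoebius w (u i) = 0 from h]
  rw [Finset.sum_eq_zero_iff_of_nonneg
    (fun i _ => div_nonneg (by positivity) (Complex.normSq_nonneg _))] at hre
  have him : ∀ i, (conj z * discMoebius w (u i)).im = 0 := fun i => by
    have := hre i (Finset.mem_univ i)
    rw [div_eq_zero_iff, Complex.normSq_eq_zero] at this
    simpa using this.resolve_right (one_sub_conj_mul_ne_zero hz1 (hv i).le)
  obtain ⟨j⟩ := ‹Nonempty ι›
  have hne : ∀ i, u i ≠ u j → conj z * discMoebius w (u i) = -(conj z * discMoebius w (u j)) := by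
    intro i hij
    have hsq : (conj z * discMoebius w (u i)).re ^ 2 = (conj z * discMoebius w (u j)).re ^ 2 := by
      have e : ∀ k, (conj z * discMoebius w (u k)).re ^ 2 = ‖z‖ ^ 2 := fun k => by
        have h1 : ‖conj z * discMoebius w (u k)‖ = ‖z‖ := by simp [hv]
        rw [← h1, Complex.sq_norm, Complex.normSq_apply, him k]
        ring
      rw [e, e]
    rcases sq_eq_sq_iff_eq_or_eq_neg.1 hsq with h0 | h0
    · refine absurd ?_ hij
      have := mul_left_cancel₀ (by simpa using hz0)
        (Complex.ext h0 (by rw [him, him]) : conj z * discMoebius w (u i) = conj z * _)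
      exact discMoebius_injective hw (hu.1 i) (hu.1 j) this
    · exact Complex.ext (by simpa using h0) (by rw [Complex.neg_im, him, him, neg_zero])
  have : Nonempty ι := ⟨j⟩
  obtain ⟨k, hk, -⟩ := hu.exists_ne (u j) (u j)
  obtain ⟨l, hl, hlk⟩ := hu.exists_ne (u j) (u k)
  have := mul_left_cancel₀ (by simpa using hz0) ((hne l hl).trans (hne k hk).symm)
  exact hlk (discMoebius_injective hw (hu.1 l) (hu.1 k) this)

theorem StableConfig.eventually_re_moebiusSum_neg [Nonempty ι] {u : ι → ℂ} (hu : StableConfig u)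
    {ζ : ℂ} (hζ : ‖ζ‖ = 1) : ∀ᶠ p : (ι → ℂ) × ℂ in 𝓝 (u, ζ), (∀ i, ‖p.1 i‖ = 1) → ‖p.2‖ < 1 →
      (conj p.2 * moebiusSum p.1 p.2).re < 0 := by
  classical
  let g : (ι → ℂ) × ℂ → ℝ := fun p =>
    ∑ i, if u i = ζ then 1 else (conj p.2 * discMoebius p.2 (p.1 i)).re
  have hne : ∀ i, u i ≠ ζ → 1 - conj ζ * u i ≠ 0 := fun i hi h => hi <| by
    linear_combination (-ζ) * h - u i * mul_conj_eq_one hζ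
  have hg : ContinuousAt g (u, ζ) := by
    refine tendsto_finsetSum _ fun i _ => ?_
    by_cases hi : u i = ζ
    · simp only [hi, if_true]; exact tendsto_const_nhds
    · simp only [hi, if_false]
      have : ContinuousAt (fun p : (ι → ℂ) × ℂ => (conj p.2 * discMoebius p.2 (p.1 i)).re)
          (u, ζ) := by
        refine Complex.continuous_re.continuousAt.comp (ContinuousAt.mul (by fun_prop) ?_)
        exact ContinuousAt.div (by fun_prop) (by fun_prop) (hne i hi)
      exact this
  have hval : g (u, ζ) < 0 := by
    have e : ∀ i, (if u i = ζ then (1 : ℝ) else (conj ζ * discMoebius ζ (u i)).re) =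
        2 * (if u i = ζ then 1 else 0) - 1 := by
      intro i
      split_ifs with hi
      · norm_num
      · have : conj ζ * discMoebius ζ (u i) = -1 := by
          rw [discMoebius, mul_div_assoc', div_eq_iff (hne i hi)]
          linear_combination - mul_conj_eq_one hζ
        rw [this]; simp
    have hc := hu.card_lt ζ
    rw [Nat.card_eq_fintype_card, Fintype.card_subtype] at hc
    simp only [g, e, Finset.sum_sub_distrib, ← Finset.mul_sum, Finset.sum_boole,
      Finset.sum_const, Finset.card_univ, nsmul_eq_mul, mul_one]
    have : (2 * (Finset.univ.filter fun i => u i = ζ).card : ℝ) < Fintype.card ι := by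
      exact_mod_cast hc
    linarith
  filter_upwards [hg.eventually (gt_mem_nhds hval)] with p hp hn hw
  refine lt_of_le_of_lt ?_ hp
  rw [moebiusSum, Finset.mul_sum, Complex.re_sum]
  refine Finset.sum_le_sum fun i _ => ?_
  split_ifs
  · refine (Complex.re_le_norm _).trans ?_
    rw [norm_mul, RCLike.norm_conj, norm_discMoebius hw (hn i), mul_one]
    exact hw.le
  · exact le_rfl

/-- The function on the unit disc whose critical points are the conformal barycenters. -/
noncomputable def barycenterPotential (u : ι → ℂ) (w : ℂ) : ℝ :=
  ∑ i, (Real.log (Complex.normSq (u i - w)) - Real.log (1 - Complex.normSq w))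

theorem normSq_lt_one {w : ℂ} (hw : ‖w‖ < 1) : Complex.normSq w < 1 := by
  rw [Complex.normSq_eq_norm_sq]; nlinarith [norm_nonneg w]

theorem sub_ne_zero_of_norm {w u : ℂ} (hw : ‖w‖ < 1) (hu : ‖u‖ = 1) : u - w ≠ 0 := fun h => by
  rw [sub_eq_zero.1 h] at hu; linarith

theorem continuousOn_barycenterPotential {u : ι → ℂ} (hu : ∀ i, ‖u i‖ = 1) :
    ContinuousOn (barycenterPotential u) (Metric.ball 0 1) := by
  refine continuousOn_finsetSum _ fun i _ => ContinuousOn.sub ?_ ?_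
  · refine ContinuousOn.log (Complex.continuous_normSq.comp (by fun_prop)).continuousOn ?_
    intro w hw
    rw [mem_ball_zero_iff] at hw
    exact (Complex.normSq_pos.2 (sub_ne_zero_of_norm hw (hu i))).ne'
  · refine ContinuousOn.log (continuous_const.sub Complex.continuous_normSq).continuousOn ?_
    intro w hw
    rw [mem_ball_zero_iff] at hw
    exact (sub_pos.2 (normSq_lt_one hw)).ne'

theorem hasDerivAt_barycenterPotential {u : ι → ℂ} (hu : ∀ i, ‖u i‖ = 1) {w : ℂ} (hw : ‖w‖ < 1)
    (d : ℂ) : HasDerivAt (fun t : ℝ => barycenterPotential u (w + t * d))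
      (-(2 * (conj d * moebiusSum u w).re / (1 - Complex.normSq w))) 0 := by
  have hlin : ∀ (a b : ℂ), HasDerivAt (fun t : ℝ => Complex.normSq (a + t * b))
      (2 * (conj b * a).re) 0 := by
    intro a b
    have h : (fun t : ℝ => Complex.normSq (a + t * b)) = fun t : ℝ =>
        Complex.normSq a + t * (2 * (conj b * a).re) + t ^ 2 * Complex.normSq b := by
      ext t
      simp only [Complex.normSq_apply, Complex.add_re, Complex.add_im, Complex.mul_re,
        Complex.mul_im, Complex.ofReal_re, Complex.ofReal_im, Complex.conj_re, Complex.conj_im]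
      ring
    rw [h]
    have := (((hasDerivAt_id (0 : ℝ)).mul_const (2 * (conj b * a).re)).const_add
      (Complex.normSq a)).fun_add (((hasDerivAt_id (0 : ℝ)).fun_pow 2).mul_const (Complex.normSq b))
    simpa using this
  have hterm : ∀ i, HasDerivAt (fun t : ℝ => Real.log (Complex.normSq (u i - (w + t * d))) -
      Real.log (1 - Complex.normSq (w + t * d)))
      (-(2 * (conj d * discMoebius w (u i)).re / (1 - Complex.normSq w))) 0 := by
    intro i
    have hs := sub_ne_zero_of_norm hw (hu i)
    have hs' : Complex.normSq (u i - w) ≠ 0 := (Complex.normSq_pos.2 hs).ne'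
    have h1w : 1 - Complex.normSq w ≠ 0 := (sub_pos.2 (normSq_lt_one hw)).ne'
    have h1 : HasDerivAt (fun t : ℝ => Complex.normSq (u i - (w + t * d)))
        (2 * (conj (-d) * (u i - w)).re) 0 := by
      convert hlin (u i - w) (-d) using 3
      ring
    have h2 := (hlin w d).const_sub 1
    refine ((h1.log (by simpa using hs')).fun_sub (h2.log (by simpa using h1w))).congr_deriv ?_
    simp only [Complex.ofReal_zero, zero_mul, add_zero]
    have hden := one_sub_conj_mul_ne_zero hw (hu i).le
    have e1 : ∀ z : ℂ, ∀ r : ℝ, z.re / r = (z / r).re := fun z r => (Complex.div_ofReal_re z r).symm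
    have hA : (Complex.normSq (u i - w) : ℂ) = (u i - w) * (conj (u i) - conj w) := by
      rw [← map_sub, Complex.mul_conj]
    have hB : ((1 - Complex.normSq w : ℝ) : ℂ) = 1 - conj w * w := by
      rw [Complex.ofReal_sub, ← Complex.mul_conj, mul_comm w]; simp
    have hB0 : 1 - conj w * w ≠ 0 := one_sub_conj_mul_ne_zero hw hw.le
    have hconj : conj (u i) - conj w ≠ 0 := by
      rw [← map_sub]; exact (map_ne_zero _).2 hs
    have hx : (u i - w) / ((u i - w) * (conj (u i) - conj w)) = u i / (1 - conj w * u i) := by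
      rw [div_eq_div_iff (mul_ne_zero hs hconj) hden]
      linear_combination (-(u i - w)) * mul_conj_eq_one (hu i)
    have key : conj d * discMoebius w (u i) / ((1 - Complex.normSq w : ℝ) : ℂ) =
        conj d * (u i - w) / (Complex.normSq (u i - w) : ℂ) -
          conj d * w / ((1 - Complex.normSq w : ℝ) : ℂ) := by
      rw [hA, hB, mul_div_assoc, mul_div_assoc, mul_div_assoc, hx, ← mul_sub,
        div_sub_div _ _ hden hB0, discMoebius, div_div]
      ring
    symm
    rw [mul_div_assoc, e1, key, Complex.sub_re, ← e1, ← e1, map_neg, neg_mul, Complex.neg_re]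
    ring
  have hsum : -(2 * (conj d * moebiusSum u w).re / (1 - Complex.normSq w)) =
      ∑ i, -(2 * (conj d * discMoebius w (u i)).re / (1 - Complex.normSq w)) := by
    rw [moebiusSum, Finset.mul_sum, Complex.re_sum, Finset.mul_sum, Finset.sum_div,
      Finset.sum_neg_distrib]
  rw [hsum]
  exact HasDerivAt.fun_sum fun i _ => hterm i

theorem HasDerivAt.nonneg_of_eventually_le {f : ℝ → ℝ} {f' : ℝ} (h : HasDerivAt f f' 0)
    (hf : ∀ᶠ t in 𝓝[>] (0 : ℝ), f 0 ≤ f t) : 0 ≤ f' := by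
  refine ge_of_tendsto h.tendsto_slope_zero_right ?_
  filter_upwards [hf, self_mem_nhdsWithin] with t ht h0
  have h0 : 0 < t := h0
  rw [zero_add, smul_eq_mul]
  exact mul_nonneg (inv_nonneg.2 h0.le) (sub_nonneg.2 ht)

theorem StableConfig.exists_moebiusSum_eq_zero [Nonempty ι] {u : ι → ℂ} (hu : StableConfig u) :
    ∃ w : ℂ, ‖w‖ < 1 ∧ moebiusSum u w = 0 := by
  obtain ⟨ρ, hρ0, hρ1, hρ⟩ : ∃ ρ : ℝ, 0 < ρ ∧ ρ < 1 ∧ ∀ w : ℂ, ‖w‖ = ρ →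
      (conj w * moebiusSum u w).re < 0 := by
    have hmem : {w : ℂ | ‖w‖ < 1 → (conj w * moebiusSum u w).re < 0} ∈
        𝓝ˢ (Metric.sphere (0 : ℂ) 1) := by
      rw [mem_nhdsSet_iff_forall]
      intro ζ hζ
      have h := hu.eventually_re_moebiusSum_neg (mem_sphere_zero_iff_norm.1 hζ)
      have hc : ContinuousAt (fun w : ℂ => (u, w)) ζ := by fun_prop
      filter_upwards [hc.eventually h] with w hw
      exact hw hu.1
    obtain ⟨O, hO, hSO, hOs⟩ := mem_nhdsSet_iff_exists.1 hmem
    obtain ⟨δ, hδ, hδO⟩ := (isCompact_sphere (0 : ℂ) 1).exists_thickening_subset_open hO hSO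
    refine ⟨max (1 - δ / 2) (1 / 2), by positivity, by simp; constructor <;> linarith,
      fun w hw => ?_⟩
    have hw0 : 0 < ‖w‖ := by rw [hw]; positivity
    have hw1 : ‖w‖ < 1 := by rw [hw, max_lt_iff]; constructor <;> linarith
    refine hOs (hδO (Metric.mem_thickening_iff.2 ⟨(‖w‖⁻¹ : ℝ) • w, ?_, ?_⟩)) hw1
    · rw [mem_sphere_zero_iff_norm, norm_smul, norm_inv, norm_norm, inv_mul_cancel₀ hw0.ne']
    · have : w - (‖w‖⁻¹ : ℝ) • w = (1 - ‖w‖⁻¹) • w := by rw [sub_smul, one_smul]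
      rw [dist_eq_norm, this, norm_smul, Real.norm_eq_abs,
        abs_of_nonpos (sub_nonpos.2 ((one_le_inv₀ hw0).2 hw1.le)), neg_sub, sub_mul,
        inv_mul_cancel₀ hw0.ne', one_mul]
      have := le_max_left (1 - δ / 2) (1 / 2)
      linarith
  obtain ⟨w, hw, hmin⟩ := (isCompact_closedBall (0 : ℂ) ρ).exists_isMinOn
    ⟨0, Metric.mem_closedBall_self hρ0.le⟩ ((continuousOn_barycenterPotential hu.1).mono
      (Metric.closedBall_subset_ball hρ1))
  rw [mem_closedBall_zero_iff] at hw
  have hw1 : ‖w‖ < 1 := hw.trans_lt hρ1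
  have hY : 0 < 1 - Complex.normSq w := sub_pos.2 (normSq_lt_one hw1)
  have hdir : ∀ d : ℂ, (∀ᶠ t : ℝ in 𝓝[>] 0, ‖w + t * d‖ ≤ ρ) → (conj d * moebiusSum u w).re ≤ 0 := by
    intro d hd
    have := (hasDerivAt_barycenterPotential hu.1 hw1 d).nonneg_of_eventually_le (by
      filter_upwards [hd] with t ht
      simpa using hmin (mem_closedBall_zero_iff.2 ht))
    by_contra! h
    have : 0 < 2 * (conj d * moebiusSum u w).re / (1 - Complex.normSq w) := by positivity
    linarith
  refine ⟨w, hw1, ?_⟩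
  rcases hw.lt_or_eq with hlt | heq
  · have hc : ContinuousAt (fun t : ℝ => ‖w + t * moebiusSum u w‖) 0 := by fun_prop
    have h := hdir (moebiusSum u w) (by
      filter_upwards [nhdsWithin_le_nhds (hc.eventually (gt_mem_nhds (by simpa using hlt)))]
        with t ht
      exact ht.le)
    rw [mul_comm, Complex.mul_conj, Complex.ofReal_re] at h
    exact Complex.normSq_eq_zero.1 (le_antisymm h (Complex.normSq_nonneg _))
  · have h := hdir (-w) (by
      filter_upwards [Ioc_mem_nhdsGT (zero_lt_one' ℝ)] with t ht
      have : w + t * -w = ((1 - t : ℝ) : ℂ) * w := by push_cast; ring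
      rw [this, norm_mul, Complex.norm_real, Real.norm_eq_abs, abs_of_nonneg (by linarith [ht.2])]
      nlinarith [ht.1, norm_nonneg w])
    have h2 := hρ w heq
    rw [map_neg, neg_mul, Complex.neg_re] at h
    linarith

open Classical in
/-- The conformal barycenter of a stable configuration on the unit circle. -/
noncomputable def conformalBarycenter (u : ι → ℂ) : ℂ :=
  if h : ∃ w : ℂ, ‖w‖ < 1 ∧ moebiusSum u w = 0 then h.choose else 0

theorem StableConfig.norm_conformalBarycenter_lt [Nonempty ι] {u : ι → ℂ} (hu : StableConfig u) :
    ‖conformalBarycenter u‖ < 1 := by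
  rw [conformalBarycenter, dif_pos hu.exists_moebiusSum_eq_zero]
  exact hu.exists_moebiusSum_eq_zero.choose_spec.1

theorem StableConfig.moebiusSum_conformalBarycenter [Nonempty ι] {u : ι → ℂ}
    (hu : StableConfig u) : moebiusSum u (conformalBarycenter u) = 0 := by
  rw [conformalBarycenter, dif_pos hu.exists_moebiusSum_eq_zero]
  exact hu.exists_moebiusSum_eq_zero.choose_spec.2

theorem continuousOn_conformalBarycenter [Nonempty ι] :
    ContinuousOn (conformalBarycenter : (ι → ℂ) → ℂ) {u | StableConfig u} := by
  intro u hu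
  refine (isCompact_closedBall (0 : ℂ) 1).tendsto_nhds_of_unique_mapClusterPt ?_ ?_
  · filter_upwards [self_mem_nhdsWithin] with v hv
    exact mem_closedBall_zero_iff.2 (StableConfig.norm_conformalBarycenter_lt hv).le
  · intro y hy hcl
    obtain ⟨𝒰, h𝒰, hy𝒰⟩ := mapClusterPt_iff_ultrafilter.1 hcl
    have hstable : ∀ᶠ v in (𝒰 : Filter (ι → ℂ)), StableConfig v := h𝒰 self_mem_nhdsWithin
    have hpair : Tendsto (fun v => (v, conformalBarycenter v)) 𝒰 (𝓝 (u, y)) :=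
      (tendsto_id'.2 (h𝒰.trans nhdsWithin_le_nhds)).prodMk_nhds hy𝒰
    rw [mem_closedBall_zero_iff] at hy
    rcases hy.lt_or_eq with hlt | heq
    · refine hu.moebiusSum_unique hlt hu.norm_conformalBarycenter_lt ?_
        hu.moebiusSum_conformalBarycenter
      have hc : ContinuousAt (fun p : (ι → ℂ) × ℂ => moebiusSum p.1 p.2) (u, y) :=
        tendsto_finsetSum _ fun i _ => ContinuousAt.div (by fun_prop) (by fun_prop)
          (one_sub_conj_mul_ne_zero hlt (hu.1 i).le)
      refine tendsto_nhds_unique (hc.tendsto.comp hpair) (tendsto_const_nhds.congr' ?_)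
      filter_upwards [hstable] with v hv
      exact hv.moebiusSum_conformalBarycenter.symm
    · exfalso
      obtain ⟨v, hv, hvs⟩ := ((hpair.eventually (hu.eventually_re_moebiusSum_neg heq)).and
        hstable).exists
      have := hv hvs.1 hvs.norm_conformalBarycenter_lt
      simp [hvs.moebiusSum_conformalBarycenter] at this

theorem conformalBarycenter_eq_zero [Nonempty ι] {u : ι → ℂ} (hu : StableConfig u)
    (h : ∑ i, u i = 0) : conformalBarycenter u = 0 :=
  hu.moebiusSum_unique hu.norm_conformalBarycenter_lt (by simp)
    hu.moebiusSum_conformalBarycenter (by simpa [moebiusSum, discMoebius_zero_left] using h)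

theorem stableConfig_of_sum_eq_zero (hodd : Odd (Fintype.card ι)) {u : ι → ℂ}
    (hu : ∀ i, ‖u i‖ = 1) (h : ∑ i, u i = 0) : StableConfig u := by
  classical
  refine ⟨hu, fun j => ?_⟩
  rw [Nat.card_eq_fintype_card, Fintype.card_subtype]
  set S := Finset.univ.filter fun i => u i = u j with hS
  have h1 : ∑ i ∈ S, u i = S.card * u j := by
    rw [Finset.sum_congr rfl fun i hi => (Finset.mem_filter.1 hi).2, Finset.sum_const,
      nsmul_eq_mul]
  have h2 : ‖∑ i ∈ Sᶜ, u i‖ ≤ Sᶜ.card := by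
    refine (norm_sum_le _ _).trans ?_
    simp [hu]
  have h3 : ∑ i ∈ Sᶜ, u i = -(S.card * u j) := by
    rw [← h1, eq_neg_iff_add_eq_zero, Finset.sum_compl_add_sum, h]
  rw [h3, norm_neg, norm_mul, hu, mul_one, Complex.norm_natCast, Nat.cast_le,
    Finset.card_compl] at h2
  have := S.card_le_univ
  obtain ⟨k, hk⟩ := hodd
  omega

end Barycenter
section PolygonSpace

theorem torusExp_add_sub {ι : Type*} {θ θ₀ θ₁ : ι → ℝ} (h : torusExp θ₁ = torusExp θ₀) :
    torusExp (θ + (θ₁ - θ₀)) = torusExp θ := by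
  ext i
  have h := congrFun h i
  simp only [torusExp, Circle.coe_inj, Pi.add_apply, Pi.sub_apply, Circle.exp_add,
    Circle.exp_sub] at *
  rw [h, div_self', mul_one]

theorem exists_torusExp_eq {ι : Type*} {u : ι → ℂ} (hu : ∀ i, ‖u i‖ = 1) :
    ∃ θ, torusExp θ = u :=
  ⟨fun i => (u i).arg, funext fun i => by
    rw [torusExp, Circle.coe_exp]
    simpa [hu] using Complex.norm_mul_exp_arg_mul_I (u i)⟩

theorem exists_lift_torusExp {ι : Type*} {γ : I → ι → ℂ} (hγ : Continuous γ)
    (hn : ∀ t i, ‖γ t i‖ = 1) {θ₀ : ι → ℝ} (h₀ : torusExp θ₀ = γ 0) :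
    ∃ θ : C(I, ι → ℝ), θ 0 = θ₀ ∧ ∀ t, torusExp (θ t) = γ t := by
  let c : ∀ i, C(I, Circle) := fun i =>
    ⟨fun t => ⟨γ t i, mem_sphere_zero_iff_norm.2 (hn t i)⟩,
      Continuous.subtype_mk ((continuous_apply i).comp hγ) _⟩
  have hc : ∀ i, c i 0 = Circle.exp (θ₀ i) := fun i => Circle.ext (congrFun h₀ i).symm
  refine ⟨⟨fun t i => Circle.isCoveringMap_exp.liftPath (c i) (θ₀ i) (hc i) t,
    continuous_pi fun i => map_continuous _⟩, ?_, fun t => ?_⟩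
  · ext i
    exact Circle.isCoveringMap_exp.liftPath_zero _ _ (hc i)
  · ext i
    exact congrArg Subtype.val
      (congrFun (Circle.isCoveringMap_exp.liftPath_lifts (c i) (θ₀ i) (hc i)) t)

/-- Move the conformal barycenter of a configuration to the origin, and rotate the point with
index `0` to `1`. -/
noncomputable def normalizeConfig {m : ℕ} (u : Fin (m + 1) → ℂ) (j : Fin m) : ℂ :=
  discMoebius (conformalBarycenter u) (u j.succ) / discMoebius (conformalBarycenter u) (u 0)

variable {m : ℕ}

theorem StableConfig.discMoebius_ne_zero {u : Fin (m + 1) → ℂ} (hu : StableConfig u)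
    (i : Fin (m + 1)) : discMoebius (conformalBarycenter u) (u i) ≠ 0 := by
  rw [← norm_ne_zero_iff, norm_discMoebius hu.norm_conformalBarycenter_lt (hu.1 i)]
  exact one_ne_zero

theorem StableConfig.normalizeConfig_mem {u : Fin (m + 1) → ℂ} (hu : StableConfig u) :
    (∀ j, ‖normalizeConfig u j‖ = 1) ∧ ∑ j, normalizeConfig u j = -1 := by
  constructor
  · intro j
    rw [normalizeConfig, norm_div, norm_discMoebius hu.norm_conformalBarycenter_lt (hu.1 _),
      norm_discMoebius hu.norm_conformalBarycenter_lt (hu.1 _), div_one]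
  · have h := hu.moebiusSum_conformalBarycenter
    rw [moebiusSum, Fin.sum_univ_succ] at h
    simp only [normalizeConfig]
    rw [← Finset.sum_div, div_eq_iff (hu.discMoebius_ne_zero 0)]
    linear_combination h

theorem continuousOn_normalizeConfig :
    ContinuousOn (normalizeConfig : (Fin (m + 1) → ℂ) → Fin m → ℂ) {u | StableConfig u} := by
  have h : ∀ i : Fin (m + 1), ContinuousOn
      (fun u : Fin (m + 1) → ℂ => discMoebius (conformalBarycenter u) (u i))
      {u | StableConfig u} := by
    intro i
    have hb := continuousOn_conformalBarycenter (ι := Fin (m + 1))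
    have hi : ContinuousOn (fun u : Fin (m + 1) → ℂ => u i) {u | StableConfig u} :=
      (continuous_apply i).continuousOn
    refine ContinuousOn.div (hi.sub hb) (continuousOn_const.sub
      ((Complex.continuous_conj.comp_continuousOn hb).mul hi)) fun u hu => ?_
    exact one_sub_conj_mul_ne_zero (StableConfig.norm_conformalBarycenter_lt hu) (hu.1 i).le
  exact continuousOn_pi.2 fun j => (h j.succ).div (h 0) fun u hu =>
    StableConfig.discMoebius_ne_zero hu 0

theorem normalizeConfig_cons {x : Fin m → ℂ} (h : StableConfig (Fin.cons 1 x : Fin (m + 1) → ℂ))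
    (hx : ∑ j, x j = -1) : normalizeConfig (Fin.cons 1 x : Fin (m + 1) → ℂ) = x := by
  ext j
  rw [normalizeConfig, conformalBarycenter_eq_zero h (by simp [Fin.sum_univ_succ, hx])]
  simp [discMoebius_zero_left]

theorem stableConfig_cons (hodd : Odd (m + 1)) {x : Fin m → ℂ} (hx : ∀ j, ‖x j‖ = 1)
    (hsum : ∑ j, x j = -1) : StableConfig (Fin.cons 1 x : Fin (m + 1) → ℂ) :=
  stableConfig_of_sum_eq_zero (by simpa using hodd)
    (fun i => by cases i using Fin.cases <;> simp [hx]) (by simp [Fin.sum_univ_succ, hsum])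

end PolygonSpace

/-- For odd `n ≥ 7`, the fundamental group of the configuration space
`M̃ = {u ∈ (S¹)^{n-1} : Σ u_i = -1}` of the closed planar equilateral `n`-gon (modulo
orientation-preserving isometries of the plane) is abelian at every basepoint.
Here `n = m + 1`. -/
theorem fundamentalGroup_equilateral_polygon_abelian (m : ℕ) (hm : 7 ≤ m + 1)
    (hodd : Odd (m + 1))
    (x : {u : Fin m → ℂ // (∀ i, ‖u i‖ = 1) ∧ ∑ i, u i = -1}) :
    ∀ a b : FundamentalGroup {u : Fin m → ℂ // (∀ i, ‖u i‖ = 1) ∧ ∑ i, u i = -1} x,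
      a * b = b * a := by
  let M := {u : Fin m → ℂ // (∀ i, ‖u i‖ = 1) ∧ ∑ i, u i = -1}
  let U : Set (Fin (m + 1) → ℝ) := {θ | StableConfig (torusExp θ)}
  let close : M → Fin (m + 1) → ℂ := fun y => Fin.cons 1 y.1
  have hclose : Continuous close := continuous_pi fun i => by
    cases i using Fin.cases with
    | zero => exact continuous_const
    | succ j => exact (continuous_apply j).comp continuous_subtype_val
  have hstable : ∀ y : M, StableConfig (close y) := fun y => stableConfig_cons hodd y.2.1 y.2.2
  let R : U → M := fun θ => ⟨normalizeConfig (torusExp θ.1), θ.2.normalizeConfig_mem⟩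
  have hR : Continuous R := Continuous.subtype_mk (continuousOn_normalizeConfig.comp_continuous
    (continuous_torusExp.comp continuous_subtype_val) fun θ => θ.2) _
  have hRclose : ∀ (θ : U) (y : M), torusExp θ.1 = close y → R θ = y := fun θ y h =>
    Subtype.ext ((congrArg normalizeConfig h).trans (normalizeConfig_cons (hstable y) y.2.2))
  have hmemU : ∀ {θ : Fin (m + 1) → ℝ} (y : M), torusExp θ = close y → θ ∈ U := fun y h => by
    change StableConfig _
    rw [h]
    exact hstable y
  have hU : IsOpen U := isOpen_stableConfig_torusExp
  have hsc : ∀ {p q : U} (γ δ : Path p q), γ.Homotopic δ := fun γ δ =>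
    Path.homotopic_of_exists_cone hU
      (fun V hV => exists_cone_point_stableConfig (by simpa using hm) hV) γ δ
  have comm : ∀ α β : Path x x, (α.trans β).Homotopic (β.trans α) := by
    intro α β
    obtain ⟨θ₀, hθ₀⟩ := exists_torusExp_eq (hstable x).1
    have hlift : ∀ γ : Path x x, ∃ θ : C(I, Fin (m + 1) → ℝ), θ 0 = θ₀ ∧
        ∀ t, torusExp (θ t) = close (γ t) := fun γ =>
      exists_lift_torusExp (hclose.comp γ.continuous) (fun t => (hstable (γ t)).1)
        (by simpa using hθ₀)
    obtain ⟨f, hf0, hf⟩ := hlift α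
    obtain ⟨g, hg0, hg⟩ := hlift β
    have hf1 : torusExp (f 1) = torusExp θ₀ := by rw [hf, hθ₀, α.target]
    have hg1 : torusExp (g 1) = torusExp θ₀ := by rw [hg, hθ₀, β.target]
    have hf' : ∀ t, torusExp (f t + (g 1 - θ₀)) = close (α t) := fun t => by
      rw [torusExp_add_sub hg1, hf]
    have hg' : ∀ t, torusExp (g t + (f 1 - θ₀)) = close (β t) := fun t => by
      rw [torusExp_add_sub hf1, hg]
    let A : Path (⟨θ₀, hmemU x hθ₀⟩ : U) ⟨f 1, hmemU _ (hf 1)⟩ :=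
      { toFun := fun t => ⟨f t, hmemU _ (hf t)⟩
        continuous_toFun := Continuous.subtype_mk (map_continuous f) _
        source' := Subtype.ext hf0
        target' := rfl }
    let B : Path (⟨θ₀, hmemU x hθ₀⟩ : U) ⟨g 1, hmemU _ (hg 1)⟩ :=
      { toFun := fun t => ⟨g t, hmemU _ (hg t)⟩
        continuous_toFun := Continuous.subtype_mk (map_continuous g) _
        source' := Subtype.ext hg0
        target' := rfl }
    let A' : Path (⟨g 1, hmemU _ (hg 1)⟩ : U) ⟨g 1 + (f 1 - θ₀), hmemU _ (hg' 1)⟩ :=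
      { toFun := fun t => ⟨f t + (g 1 - θ₀), hmemU _ (hf' t)⟩
        continuous_toFun := Continuous.subtype_mk ((map_continuous f).add continuous_const) _
        source' := Subtype.ext (by simp [hf0])
        target' := Subtype.ext (by simp only; abel) }
    let B' : Path (⟨f 1, hmemU _ (hf 1)⟩ : U) ⟨g 1 + (f 1 - θ₀), hmemU _ (hg' 1)⟩ :=
      { toFun := fun t => ⟨g t + (f 1 - θ₀), hmemU _ (hg' t)⟩
        continuous_toFun := Continuous.subtype_mk ((map_continuous g).add continuous_const) _
        source' := Subtype.ext (by simp [hg0])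
        target' := rfl }
    have h := (hsc (A.trans B') (B.trans A')).map ⟨R, hR⟩
    have hproj : ∀ {p q r : U} (γ : Path p q) (δ : Path q r) (γ' δ' : Path x x),
        (∀ t, R (γ t) = γ' t) → (∀ t, R (δ t) = δ' t) →
        ((γ.trans δ).map hR).toContinuousMap = (γ'.trans δ').toContinuousMap := by
      intro p q r γ δ γ' δ' h1 h2
      refine ContinuousMap.ext fun t => ?_
      change R ((γ.trans δ) t) = (γ'.trans δ') t
      rw [Path.trans_apply, Path.trans_apply]
      split_ifs
      · exact h1 _
      · exact h2 _
    change ContinuousMap.HomotopicRel (α.trans β).toContinuousMap (β.trans α).toContinuousMap _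
    rw [← hproj A B' α β (fun t => hRclose _ _ (hf t)) (fun t => hRclose _ _ (hg' t)),
      ← hproj B A' β α (fun t => hRclose _ _ (hg t)) (fun t => hRclose _ _ (hf' t))]
    exact h
  intro a b
  induction a using Path.Homotopic.Quotient.ind with | _ α
  induction b using Path.Homotopic.Quotient.ind with | _ β
  rw [FundamentalGroup.mul_def, FundamentalGroup.mul_def, ← Path.Homotopic.Quotient.mk_trans,
    ← Path.Homotopic.Quotient.mk_trans]
  exact Path.Homotopic.Quotient.eq.2 (comm β α)
end
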